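/- arXiv:1710.04529 — 3 statements merged into one kernel-verified Lean document; each statement's English description precedes it below -/
import Mathlib

section
/- Let Ω be a bounded open subset of ℝ^d, T > 0 and Ω_T = Ω × (0,T). Let f : ℝ → ℝ^d be C¹ with bounded derivative, let B : ℝ → ℝ be C³ and bounded with B(s) ≥ r > 0 for all s ∈ ℝ, and let ε > 0. Let u_{0ε} ∈ C_c^∞(Ω) with ‖u_{0ε}‖_{L^∞(Ω)} ≤ A for a constant A > 0. If u^ε ∈ C²(closure(Ω_T)) is a classical solution of ∂_t u^ε + ∇·(f(u^ε)) = ε ∇·(B(u^ε) ∇u^ε) in Ω_T with u^ε = 0 on ∂Ω × (0,T) and u^ε(·,0) = u_{0ε}, then ε ∑_{j=1}^d ∫_{Ω_T} |∂u^ε/∂x_j|² dx dt ≤ (1/(2r)) ‖u_{0ε}‖²_{L²(Ω)} ≤ (1/(2r)) Vol(Ω) A². -/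
open MeasureTheory Set Filter Topology

noncomputable section

/-- `j`-th spatial partial derivative of a function of (space, time). -/
def pdX (d : ℕ) (u : (Fin d → ℝ) × ℝ → ℝ) (j : Fin d) (p : (Fin d → ℝ) × ℝ) : ℝ :=
  fderiv ℝ u p (Pi.single j 1, 0)

/-- time partial derivative of a function of (space, time). -/
def pdT (d : ℕ) (u : (Fin d → ℝ) × ℝ → ℝ) (p : (Fin d → ℝ) × ℝ) : ℝ :=
  fderiv ℝ u p (0, 1)

/-- second spatial partial derivative in direction `j`. -/
def pdXX (d : ℕ) (u : (Fin d → ℝ) × ℝ → ℝ) (j : Fin d) (p : (Fin d → ℝ) × ℝ) : ℝ :=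
  fderiv ℝ (pdX d u j) p (Pi.single j 1, 0)

/-- spatial Laplacian of a function of (space, time). -/
def lapX (d : ℕ) (u : (Fin d → ℝ) × ℝ → ℝ) (p : (Fin d → ℝ) × ℝ) : ℝ :=
  ∑ j, pdXX d u j p

/-- Euclidean norm of the spatial gradient of a function of (space, time). -/
def gradXNorm (d : ℕ) (u : (Fin d → ℝ) × ℝ → ℝ) (p : (Fin d → ℝ) × ℝ) : ℝ :=
  Real.sqrt (∑ j, (pdX d u j p) ^ 2)

/-- `j`-th partial derivative of a function of space only. -/
def pd (d : ℕ) (v : (Fin d → ℝ) → ℝ) (j : Fin d) (x : Fin d → ℝ) : ℝ :=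
  fderiv ℝ v x (Pi.single j 1)

/-- Laplacian of a function of space only. -/
def lap (d : ℕ) (v : (Fin d → ℝ) → ℝ) (x : Fin d → ℝ) : ℝ :=
  ∑ j, pd d (pd d v j) j x

/-- Euclidean norm of the gradient of a function of space only. -/
def gradNorm (d : ℕ) (v : (Fin d → ℝ) → ℝ) (x : Fin d → ℝ) : ℝ :=
  Real.sqrt (∑ j, (pd d v j x) ^ 2)

/-- `L^∞(Ω)` norm (essential supremum of the absolute value over `Ω`). -/
def linf (d : ℕ) (Ω : Set (Fin d → ℝ)) (v : (Fin d → ℝ) → ℝ) : ℝ :=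
  essSup (fun x => |v x|) (volume.restrict Ω)

/-- `sup_{y ∈ s} |g'(y)|`. -/
def supDerivOn (g : ℝ → ℝ) (s : Set ℝ) : ℝ :=
  sSup ((fun y => |deriv g y|) '' s)

/-- The flux `f = (f_1, …, f_d)` is `C¹` with bounded derivative. -/
def FluxOK (d : ℕ) (f : Fin d → ℝ → ℝ) : Prop :=
  (∀ j, ContDiff ℝ 1 (f j)) ∧ ∃ M, ∀ j y, |deriv (f j) y| ≤ M

/-- The diffusion coefficient `B` is `C³`, bounded, and `B ≥ r`. -/
def DiffusionOK (B : ℝ → ℝ) (r : ℝ) : Prop :=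
  ContDiff ℝ 3 B ∧ (∃ M, ∀ s, |B s| ≤ M) ∧ 0 < r ∧ ∀ s, r ≤ B s

/-- A classical solution (in `C²(closure Ω_T)`) of the regularized viscosity problem
`∂ₜ u + ∇·(f(u)) = ε ∇·(B(u) ∇u)` on `Ω_T = Ω × (0,T)`, vanishing on `∂Ω × (0,T)`,
with initial data `u0e` at `t = 0`. -/
structure IsSolution (d : ℕ) (Ω : Set (Fin d → ℝ)) (T : ℝ)
    (f : Fin d → ℝ → ℝ) (B : ℝ → ℝ) (ε : ℝ)
    (u0e : (Fin d → ℝ) → ℝ) (u : (Fin d → ℝ) × ℝ → ℝ) : Prop where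
  smooth : ContDiffOn ℝ 2 u (closure (Ω ×ˢ Ioo (0:ℝ) T))
  pde : ∀ x ∈ Ω, ∀ t ∈ Ioo (0:ℝ) T,
    pdT d u (x, t) + ∑ j, deriv (f j) (u (x, t)) * pdX d u j (x, t)
      = ε * (B (u (x, t)) * lapX d u (x, t)
          + deriv B (u (x, t)) * ∑ j, pdX d u j (x, t) ^ 2)
  bdry : ∀ x ∈ frontier Ω, ∀ t ∈ Ioo (0:ℝ) T, u (x, t) = 0
  init : ∀ x ∈ Ω, u (x, 0) = u0e x

/-- A standard mollifier profile on `ℝ^d`: smooth, nonnegative, supported in the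
closed Euclidean unit ball, with integral 1. -/
def IsMollifier (d : ℕ) (ρ : (Fin d → ℝ) → ℝ) : Prop :=
  ContDiff ℝ (⊤ : ℕ∞) ρ ∧ HasCompactSupport ρ ∧ (∀ x, 0 ≤ ρ x) ∧
  (∀ x, ρ x ≠ 0 → ∑ j, (x j) ^ 2 ≤ 1) ∧ (∫ x, ρ x) = 1

/-- Mollification `v ⋆ ρ_ε` with `ρ_ε(x) = ε^{-d} ρ(x/ε)`. -/
def mollify (d : ℕ) (ρ : (Fin d → ℝ) → ℝ) (ε : ℝ) (v : (Fin d → ℝ) → ℝ)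
    (x : Fin d → ℝ) : ℝ :=
  ∫ y, v y * ((ε ^ d)⁻¹ * ρ (ε⁻¹ • (x - y)))

/-- `v ∈ L^∞` with essential support a compact subset of `Ω`, extended by zero
outside `Ω`. -/
def LinfCompactData (d : ℕ) (Ω : Set (Fin d → ℝ)) (v : (Fin d → ℝ) → ℝ) : Prop :=
  (∃ M, ∀ᵐ x, |v x| ≤ M) ∧ (∀ x ∉ Ω, v x = 0) ∧
  ∃ K, IsCompact K ∧ K ⊆ Ω ∧ ∀ᵐ x, x ∉ K → v x = 0

/-- The set of numbers `∫_Ω v · div φ` over test vector fields `φ ∈ C_c¹(Ω; ℝ^d)`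
with `|φ| ≤ 1`, whose supremum is the total variation. -/
def tvSet (d : ℕ) (Ω : Set (Fin d → ℝ)) (v : (Fin d → ℝ) → ℝ) : Set ℝ :=
  { a | ∃ φ : Fin d → (Fin d → ℝ) → ℝ,
      (∀ j, ContDiff ℝ 1 (φ j)) ∧ (∀ j, HasCompactSupport (φ j)) ∧
      (∀ j, tsupport (φ j) ⊆ Ω) ∧ (∀ x, ∑ j, (φ j x) ^ 2 ≤ 1) ∧
      a = ∫ x in Ω, v x * ∑ j, pd d (φ j) j x }

/-- Total variation of `v` over `Ω`. -/
def TV (d : ℕ) (Ω : Set (Fin d → ℝ)) (v : (Fin d → ℝ) → ℝ) : ℝ :=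
  sSup (tvSet d Ω v)

/-- `v ∈ BV(Ω)`: integrable with finite total variation. -/
def MemBV (d : ℕ) (Ω : Set (Fin d → ℝ)) (v : (Fin d → ℝ) → ℝ) : Prop :=
  IntegrableOn v Ω ∧ BddAbove (tvSet d Ω v)

/-! ### Regularity up to the boundary -/

/-- `g` agrees, near `x` inside `Q`, with a function that is `C^n` within `S` at `x`. -/
def LocExt {E : Type*} [NormedAddCommGroup E] [NormedSpace ℝ E] (n : ℕ) (Q S : Set E)
    (g : E → ℝ) (x : E) : Prop :=
  ∃ h : E → ℝ, ContDiffWithinAt ℝ n h S x ∧ ∀ᶠ y in 𝓝[Q] x, g y = h y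

lemma LocExt.fderiv {E : Type*} [NormedAddCommGroup E] [NormedSpace ℝ E] {n : ℕ} {Q S : Set E}
    {g : E → ℝ} {x : E} (hQ : IsOpen Q) (hQS : Q ⊆ S) (hx : x ∈ S)
    (hg : LocExt (n + 1) Q S g x) (v : E) : LocExt n Q S (fun y => fderiv ℝ g y v) x := by
  obtain ⟨h, hh, hgh⟩ := hg
  have hh' : ContDiffWithinAt ℝ ((n : WithTop ℕ∞) + 1) h S x := by exact_mod_cast hh
  rw [contDiffWithinAt_succ_iff_hasFDerivWithinAt' (by simp)] at hh'
  obtain ⟨w, hw, -, -, f', hf', hf'n⟩ := hh'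
  rw [insert_eq_of_mem hx] at hw
  refine ⟨fun y => f' y v, hf'n.clm_apply contDiffWithinAt_const, ?_⟩
  have hwQ : w ∈ 𝓝[Q] x := nhdsWithin_mono x hQS hw
  filter_upwards [hwQ, eventually_eventually_nhdsWithin.2 hgh, self_mem_nhdsWithin]
    with y hy1 hy2 hyQ
  rw [hQ.nhdsWithin_eq hyQ] at hy2
  have h1 : HasFDerivAt h (f' y) y :=
    (hf' y hy1).hasFDerivAt (mem_of_superset (hQ.mem_nhds hyQ) hQS)
  have h2 : HasFDerivAt g (f' y) y := h1.congr_of_eventuallyEq hy2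
  simp [h2.fderiv]

lemma LocExt.bdd {E : Type*} [NormedAddCommGroup E] [NormedSpace ℝ E] {n : ℕ} {Q S : Set E}
    {g : E → ℝ} (hQS : Q ⊆ S) (hS : IsCompact S)
    (hg : ∀ x ∈ S, LocExt n Q S g x) : ∃ C, ∀ y ∈ Q, |g y| ≤ C := by
  have key : ∃ C, ∀ y ∈ S ∩ Q, |g y| ≤ C := by
    refine hS.induction_on (p := fun s => ∃ C, ∀ y ∈ s ∩ Q, |g y| ≤ C) ?_ ?_ ?_ ?_
    · exact ⟨0, by simp⟩
    · rintro s t hst ⟨C, hC⟩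
      exact ⟨C, fun y hy => hC y ⟨hst hy.1, hy.2⟩⟩
    · rintro s t ⟨C, hC⟩ ⟨D, hD⟩
      refine ⟨max C D, ?_⟩
      rintro y ⟨hy | hy, hyQ⟩
      · exact (hC y ⟨hy, hyQ⟩).trans (le_max_left _ _)
      · exact (hD y ⟨hy, hyQ⟩).trans (le_max_right _ _)
    · intro x hx
      obtain ⟨h, hh, hgh⟩ := hg x hx
      have hc : Tendsto (fun y => |h y|) (𝓝[S] x) (𝓝 |h x|) := hh.continuousWithinAt.abs
      have h1 : ∀ᶠ y in 𝓝[S] x, |h y| < |h x| + 1 := hc.eventually_lt_const (by linarith)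
      have h2 : ∀ᶠ y in 𝓝[Q] x, |g y| ≤ |h x| + 1 := by
        filter_upwards [hgh, nhdsWithin_mono x hQS h1] with y a b
        rw [a]; exact le_of_lt b
      rw [eventually_nhdsWithin_iff] at h2
      exact ⟨{y | y ∈ Q → |g y| ≤ |h x| + 1}, mem_nhdsWithin_of_mem_nhds h2,
        |h x| + 1, fun y hy => hy.1 hy.2⟩
  obtain ⟨C, hC⟩ := key
  exact ⟨C, fun y hy => hC y ⟨hQS hy, hy⟩⟩

/-- continuous and bounded on `Q`. -/
def CB {E : Type*} [TopologicalSpace E] (Q : Set E) (g : E → ℝ) : Prop :=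
  ContinuousOn g Q ∧ ∃ C, ∀ y ∈ Q, |g y| ≤ C

lemma CB.mul {E : Type*} [TopologicalSpace E] {Q : Set E} {g h : E → ℝ}
    (hg : CB Q g) (hh : CB Q h) : CB Q (fun x => g x * h x) := by
  obtain ⟨hg, C, hC⟩ := hg
  obtain ⟨hh, D, hD⟩ := hh
  refine ⟨hg.mul hh, C * D, fun y hy => ?_⟩
  rw [abs_mul]
  exact mul_le_mul (hC y hy) (hD y hy) (abs_nonneg _) ((abs_nonneg _).trans (hC y hy))

lemma CB.add {E : Type*} [TopologicalSpace E] {Q : Set E} {g h : E → ℝ}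
    (hg : CB Q g) (hh : CB Q h) : CB Q (fun x => g x + h x) := by
  obtain ⟨hg, C, hC⟩ := hg
  obtain ⟨hh, D, hD⟩ := hh
  exact ⟨hg.add hh, C + D, fun y hy => (abs_add_le _ _).trans (add_le_add (hC y hy) (hD y hy))⟩

lemma CB.const {E : Type*} [TopologicalSpace E] {Q : Set E} (c : ℝ) :
    CB Q (fun _ : E => c) := ⟨continuousOn_const, |c|, fun _ _ => le_rfl⟩

lemma CB.comp {E : Type*} [TopologicalSpace E] {Q : Set E} {g : E → ℝ}
    (hg : CB Q g) {F : ℝ → ℝ} (hF : Continuous F) : CB Q (fun x => F (g x)) := by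
  obtain ⟨hg, C, hC⟩ := hg
  obtain ⟨D, hD⟩ := (isCompact_Icc (a := -C) (b := C)).exists_bound_of_continuousOn
    hF.continuousOn
  exact ⟨hF.comp_continuousOn hg, D, fun y hy => hD _ (abs_le.1 (hC y hy))⟩

lemma CB.comp_left {E E' : Type*} [TopologicalSpace E] [TopologicalSpace E'] {Q : Set E}
    {Q' : Set E'} {g : E → ℝ} (hg : CB Q g) {F : E' → E} (hF : Continuous F)
    (hm : MapsTo F Q' Q) : CB Q' (fun x => g (F x)) := by
  obtain ⟨hg, C, hC⟩ := hg
  exact ⟨hg.comp hF.continuousOn hm, C, fun y hy => hC _ (hm hy)⟩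

lemma CB.integrableOn {E : Type*} [TopologicalSpace E] [MeasurableSpace E]
    [OpensMeasurableSpace E] {μ : Measure E} {Q : Set E} {g : E → ℝ}
    (hg : CB Q g) (hQ : IsOpen Q) (hfin : μ Q ≠ ⊤) : IntegrableOn g Q μ := by
  obtain ⟨hg, C, hC⟩ := hg
  refine IntegrableOn.of_bound hfin.lt_top (hg.aestronglyMeasurable hQ.measurableSet) C ?_
  filter_upwards [ae_restrict_mem hQ.measurableSet] with y hy using hC y hy

/-! ### The truncated test function -/

/-- the truncation `s ↦ s χ(n s² - 1)`. -/
def phi (n : ℕ) (s : ℝ) : ℝ := s * Real.smoothTransition (n * s ^ 2 - 1)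

lemma phi_contDiff (n : ℕ) : ContDiff ℝ 1 (phi n) := by
  unfold phi
  have : ContDiff ℝ 1 Real.smoothTransition := Real.smoothTransition.contDiff (n := 1)
  exact contDiff_id.mul (this.comp (by fun_prop))

lemma phi_hasDerivAt (n : ℕ) (s : ℝ) : HasDerivAt (phi n) (deriv (phi n) s) s :=
  ((phi_contDiff n).differentiable one_ne_zero s).hasDerivAt

lemma phi_eq_zero {n : ℕ} {s : ℝ} (h : n * s ^ 2 ≤ 1) : phi n s = 0 := by
  simp [phi, Real.smoothTransition.zero_of_nonpos (sub_nonpos.2 h)]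

lemma phi_deriv (n : ℕ) (s : ℝ) : deriv (phi n) s =
    Real.smoothTransition (n * s ^ 2 - 1)
      + 2 * n * s ^ 2 * deriv Real.smoothTransition (n * s ^ 2 - 1) := by
  have h0 : ContDiff ℝ 1 Real.smoothTransition := Real.smoothTransition.contDiff (n := 1)
  have h1 := (h0.differentiable one_ne_zero (n * s ^ 2 - 1)).hasDerivAt
  have h2 : HasDerivAt (fun s : ℝ => n * s ^ 2 - 1) (n * (2 * s)) s := by
    simpa using ((hasDerivAt_pow 2 s).const_mul (n : ℝ)).sub_const 1
  have h3 := (hasDerivAt_id s).mul (h1.comp s h2)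
  have h4 : HasDerivAt (phi n) _ s := h3
  rw [h4.deriv]
  simp only [Function.comp, id]
  ring

lemma phi_deriv_nonneg (n : ℕ) (s : ℝ) : 0 ≤ deriv (phi n) s := by
  rw [phi_deriv]
  have := Real.smoothTransition.nonneg (n * s ^ 2 - 1)
  have h : 0 ≤ deriv Real.smoothTransition (n * s ^ 2 - 1) :=
    Real.smoothTransition.monotone.deriv_nonneg
  positivity

lemma phi_deriv_ge_one {n : ℕ} {s : ℝ} (hs : 2 ≤ n * s ^ 2) : 1 ≤ deriv (phi n) s := by
  rw [phi_deriv, Real.smoothTransition.one_of_one_le (by linarith)]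
  have h : 0 ≤ deriv Real.smoothTransition (n * s ^ 2 - 1) :=
    Real.smoothTransition.monotone.deriv_nonneg
  have : 0 ≤ 2 * n * s ^ 2 * deriv Real.smoothTransition (n * s ^ 2 - 1) := by positivity
  linarith

/-- primitive of `c * phi n` vanishing at `0`. -/
def prim (c : ℝ → ℝ) (n : ℕ) (s : ℝ) : ℝ := ∫ y in (0 : ℝ)..s, c y * phi n y

lemma prim_hasDerivAt {c : ℝ → ℝ} (hc : Continuous c) (n : ℕ) (s : ℝ) :
    HasDerivAt (prim c n) (c s * phi n s) s := by
  have : Continuous (fun y => c y * phi n y) := hc.mul (phi_contDiff n).continuous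
  exact this.integral_hasStrictDerivAt 0 s |>.hasDerivAt

lemma prim_eq_zero {c : ℝ → ℝ} {n : ℕ} {s : ℝ} (h : n * s ^ 2 ≤ 1) : prim c n s = 0 := by
  unfold prim
  refine intervalIntegral.integral_zero_ae (Eventually.of_forall fun y hy => ?_)
  have : y ^ 2 ≤ s ^ 2 := by
    rw [sq_le_sq]
    rcases le_total 0 s with h0 | h0
    · rw [uIoc_of_le h0] at hy
      rw [abs_of_pos hy.1, abs_of_nonneg h0]; exact hy.2
    · rw [uIoc_of_ge h0] at hy
      rw [abs_of_nonpos hy.2, abs_of_nonpos h0]; linarith [hy.1]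
  rw [phi_eq_zero, mul_zero]
  exact (mul_le_mul_of_nonneg_left this n.cast_nonneg).trans h

lemma prim_one_bounds (n : ℕ) (s : ℝ) :
    0 ≤ prim (fun _ => 1) n s ∧ prim (fun _ => 1) n s ≤ s ^ 2 / 2 := by
  have hd : ∀ y, HasDerivAt (prim (fun _ => 1) n) (phi n y) y := fun y => by
    simpa using prim_hasDerivAt (c := fun _ => 1) continuous_const n y
  have h0 : prim (fun _ => 1) n 0 = 0 := prim_eq_zero (by simp)
  have hd2 : ∀ y, HasDerivAt (fun y => y ^ 2 / 2 - prim (fun _ => 1) n y) (y - phi n y) y :=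
    fun y => by
      have := ((hasDerivAt_pow 2 y).div_const 2).sub (hd y)
      convert! this using 1
      simp
  have hχ0 : ∀ y : ℝ, 0 ≤ Real.smoothTransition (n * y ^ 2 - 1) := fun y =>
    Real.smoothTransition.nonneg _
  have hχ1 : ∀ y : ℝ, 0 ≤ 1 - Real.smoothTransition (n * y ^ 2 - 1) := fun y =>
    sub_nonneg.2 (Real.smoothTransition.le_one _)
  -- a function with derivative `y * k y`, `k ≥ 0`, vanishing at zero is nonnegative
  have gen : ∀ (F k : ℝ → ℝ), (∀ y, HasDerivAt F (y * k y) y) → (∀ y, 0 ≤ k y) → F 0 = 0 →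
      0 ≤ F s := by
    intro F k hF hk hF0
    have hcont : Continuous F := continuous_iff_continuousAt.2 fun y => (hF y).continuousAt
    rcases le_total 0 s with hs | hs
    · have : MonotoneOn F (Ici 0) := monotoneOn_of_deriv_nonneg (convex_Ici 0)
        hcont.continuousOn (fun y _ => (hF y).differentiableAt.differentiableWithinAt)
        (fun y hy => by
          rw [(hF y).deriv]; rw [interior_Ici] at hy
          exact mul_nonneg (le_of_lt hy) (hk y))
      rw [← hF0]; exact this self_mem_Ici hs hs
    · have : AntitoneOn F (Iic 0) := antitoneOn_of_deriv_nonpos (convex_Iic 0)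
        hcont.continuousOn (fun y _ => (hF y).differentiableAt.differentiableWithinAt)
        (fun y hy => by
          rw [(hF y).deriv]; rw [interior_Iic] at hy
          exact mul_nonpos_of_nonpos_of_nonneg (le_of_lt hy) (hk y))
      rw [← hF0]; exact this hs self_mem_Iic hs
  refine ⟨gen _ _ hd hχ0 h0, ?_⟩
  have := gen (fun y => y ^ 2 / 2 - prim (fun _ => 1) n y) _
    (fun y => by convert hd2 y using 1; unfold phi; ring) hχ1 (by simp [h0])
  linarith

/-! ### Two measure-theoretic facts -/

lemma countable_zero_deriv_ne (g : ℝ → ℝ) (g' : ℝ → ℝ) (s : Set ℝ)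
    (hs : ∀ t ∈ s, HasDerivAt g (g' t) t ∧ g t = 0 ∧ g' t ≠ 0) : s.Countable := by
  refine (countable_setOfPred_isolated_right_within (s := s)).mono ?_
  intro t ht
  refine ⟨ht, ?_⟩
  obtain ⟨h1, h2, h3⟩ := hs t ht
  have h4 := h1.eventually_ne h3 (c := 0)
  have h5 : ∀ᶠ z in 𝓝[s ∩ Ioi t] t, g z ≠ 0 :=
    nhdsWithin_mono t (fun z hz => ne_of_gt hz.2) h4
  have h6 : ∀ᶠ z in 𝓝[s ∩ Ioi t] t, False := by
    filter_upwards [h5, self_mem_nhdsWithin] with z hz hz2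
    exact hz (hs z hz2.1).2.1
  exact eventually_false_iff_eq_bot.1 h6

lemma ae_fderiv_zero_of_zero {d : ℕ} {Q : Set ((Fin d → ℝ) × ℝ)} (hQ : IsOpen Q)
    {u : (Fin d → ℝ) × ℝ → ℝ} (hu : ContinuousOn u Q) (hd : ∀ p ∈ Q, DifferentiableAt ℝ u p)
    (v : (Fin d → ℝ) × ℝ) :
    ∀ᵐ p, p ∈ Q → u p = 0 → fderiv ℝ u p v = 0 := by
  have hO : IsOpen (Q ∩ u ⁻¹' {0}ᶜ) := hu.isOpen_inter_preimage hQ isOpen_compl_singleton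
  have hm : MeasurableSet {p | fderiv ℝ u p v = 0} :=
    (measurable_fderiv_apply_const ℝ u v) (measurableSet_singleton 0)
  have hs : MeasurableSet {p | p ∈ Q → u p = 0 → fderiv ℝ u p v = 0} := by
    have : {p | p ∈ Q → u p = 0 → fderiv ℝ u p v = 0}
        = Qᶜ ∪ (Q ∩ u ⁻¹' {0}ᶜ) ∪ {p | fderiv ℝ u p v = 0} := by
      ext p
      simp only [mem_ofPred_eq, mem_union, mem_compl_iff, mem_inter_iff, mem_preimage,
        mem_singleton_iff]
      tauto
    rw [this]
    exact (hQ.measurableSet.compl.union hO.measurableSet).union hm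
  have : (volume : Measure ((Fin d → ℝ) × ℝ)).IsAddHaarMeasure :=
    inferInstanceAs ((volume : Measure (Fin d → ℝ)).prod
      (volume : Measure ℝ)).IsAddHaarMeasure
  suffices hk : ∀ᵐ p, p ∈ {p | p ∈ Q → u p = 0 → fderiv ℝ u p v = 0} by
    simpa only [mem_ofPred_eq] using hk
  refine ae_mem_of_ae_add_linearMap_mem
    (LinearMap.toSpanSingleton ℝ ((Fin d → ℝ) × ℝ) v) (volume : Measure ℝ) volume hs ?_
  intro y
  have hc : {t : ℝ | ¬ (y + t • v ∈ Q → u (y + t • v) = 0 →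
      fderiv ℝ u (y + t • v) v = 0)}.Countable := by
    refine countable_zero_deriv_ne (fun t => u (y + t • v))
      (fun t => fderiv ℝ u (y + t • v) v) _ ?_
    intro t ht
    simp only [mem_ofPred_eq, Classical.not_imp] at ht
    refine ⟨?_, ht.2.1, ht.2.2⟩
    have h1 := (hd _ ht.1).hasFDerivAt
    have h2 : HasDerivAt (fun t : ℝ => y + t • v) v t := by
      simpa using ((hasDerivAt_id t).smul_const v).const_add y
    exact h1.comp_hasDerivAt t h2
  have := hc.ae_notMem (volume : Measure ℝ)
  filter_upwards [this] with t ht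
  simpa using ht

lemma integral_deriv_zero {d : ℕ} {Ω : Set (Fin d → ℝ)} (hΩ : IsOpen Ω)
    (hb : Bornology.IsBounded Ω) {w w' : (Fin d → ℝ) → ℝ} (hw : CB Ω w) (hw' : CB Ω w')
    (v : Fin d → ℝ) (hd : ∀ x ∈ Ω, HasLineDerivAt ℝ w (w' x) x v)
    (hz : ∀ x ∈ frontier Ω, ∀ᶠ y in 𝓝[Ω] x, w y = 0) :
    ∫ x in Ω, w' x = 0 := by
  have hfin : volume Ω ≠ ⊤ := hb.measure_lt_top.ne
  have i1 : Integrable (Ω.indicator w) := 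
    (integrable_indicator_iff hΩ.measurableSet).2 (hw.integrableOn hΩ hfin)
  have i2 : Integrable (Ω.indicator w') := 
    (integrable_indicator_iff hΩ.measurableSet).2 (hw'.integrableOn hΩ hfin)
  have hD : ∀ x, HasLineDerivAt ℝ (Ω.indicator w) (Ω.indicator w' x) x v := by
    intro x
    by_cases hx : x ∈ Ω
    · rw [indicator_of_mem hx]
      refine (hd x hx).congr_of_eventuallyEq ?_
      filter_upwards [hΩ.mem_nhds hx] with y hy
      rw [indicator_of_mem hy]
    · rw [indicator_of_notMem hx]
      have hev : ∀ᶠ y in 𝓝 x, Ω.indicator w y = 0 := by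
        by_cases hx2 : x ∈ closure Ω
        · have := hz x ⟨hx2, by rwa [hΩ.interior_eq]⟩
          rw [eventually_nhdsWithin_iff] at this
          filter_upwards [this] with y hy
          by_cases hyΩ : y ∈ Ω
          · rw [indicator_of_mem hyΩ, hy hyΩ]
          · rw [indicator_of_notMem hyΩ]
        · filter_upwards [isClosed_closure.isOpen_compl.mem_nhds hx2] with y hy
          rw [indicator_of_notMem (fun h => hy (subset_closure h))]
      have h0 : HasLineDerivAt ℝ (fun _ : Fin d → ℝ => (0 : ℝ)) 0 x v := by
        simpa using ((hasFDerivAt_const (0 : ℝ) x).hasLineDerivAt v)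
      exact h0.congr_of_eventuallyEq hev
  have h := integral_bilinear_hasLineDerivAt_right_eq_neg_left_of_integrable
    (μ := (volume : Measure (Fin d → ℝ)))
    (f := Ω.indicator w) (f' := Ω.indicator w') (g := fun _ => (1 : ℝ)) (g' := fun _ => 0)
    (v := v) (B := ContinuousLinearMap.mul ℝ ℝ) (by simpa using i2) (by simp) (by simpa using i1)
    (fun x _ => hD x) (fun x _ => by simpa using ((hasFDerivAt_const (1 : ℝ) x).hasLineDerivAt v))
  rw [← integral_indicator hΩ.measurableSet]
  simpa using h

/-! ### The energy estimate -/

lemma cb_of_contDiffOn {E : Type*} [NormedAddCommGroup E] [NormedSpace ℝ E] {Q S : Set E}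
    {u : E → ℝ} (hQ : IsOpen Q) (hQS : Q ⊆ S) (hS : IsCompact S) (hu : ContDiffOn ℝ 2 u S) :
    CB Q u ∧ (∀ v, CB Q (fun p => fderiv ℝ u p v)) ∧
    (∀ v w, CB Q (fun p => fderiv ℝ (fun q => fderiv ℝ u q v) p w)) ∧
    (∀ p ∈ Q, DifferentiableAt ℝ u p) ∧
    (∀ v, ∀ p ∈ Q, DifferentiableAt ℝ (fun q => fderiv ℝ u q v) p) := by
  have h0 : ∀ x ∈ S, LocExt (1 + 1) Q S u x := fun x hx =>
    ⟨u, by exact_mod_cast hu x hx, Eventually.of_forall fun _ => rfl⟩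
  have h1 : ∀ v, ∀ x ∈ S, LocExt (0 + 1) Q S (fun p => fderiv ℝ u p v) x := fun v x hx =>
    (h0 x hx).fderiv hQ hQS hx v
  have h2 : ∀ v w, ∀ x ∈ S, LocExt 0 Q S (fun p => fderiv ℝ (fun q => fderiv ℝ u q v) p w) x :=
    fun v w x hx => (h1 v x hx).fderiv hQ hQS hx w
  have c0 : ContDiffOn ℝ 2 u Q := hu.mono hQS
  have c1 : ∀ v, ContDiffOn ℝ 1 (fun p => fderiv ℝ u p v) Q := fun v =>
    (c0.fderiv_of_isOpen hQ (by norm_num)).clm_apply contDiffOn_const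
  have c2 : ∀ v w, ContDiffOn ℝ 0 (fun p => fderiv ℝ (fun q => fderiv ℝ u q v) p w) Q :=
    fun v w => ((c1 v).fderiv_of_isOpen hQ (by norm_num)).clm_apply contDiffOn_const
  exact ⟨⟨c0.continuousOn, LocExt.bdd hQS hS h0⟩,
    fun v => ⟨(c1 v).continuousOn, LocExt.bdd hQS hS (h1 v)⟩,
    fun v w => ⟨(c2 v w).continuousOn, LocExt.bdd hQS hS (h2 v w)⟩,
    fun p hp => (c0.differentiableOn (by norm_num)).differentiableAt (hQ.mem_nhds hp),
    fun v p hp => ((c1 v).differentiableOn (by norm_num)).differentiableAt (hQ.mem_nhds hp)⟩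

lemma energy_trunc (d : ℕ) (Ω : Set (Fin d → ℝ)) (hΩo : IsOpen Ω)
    (hΩb : Bornology.IsBounded Ω) (T : ℝ) (hT : 0 < T)
    (f : Fin d → ℝ → ℝ) (hf : FluxOK d f)
    (B : ℝ → ℝ) (r : ℝ) (hB : DiffusionOK B r)
    (ε : ℝ) (hε : 0 < ε)
    (u0e : (Fin d → ℝ) → ℝ) (hu0sq : IntegrableOn (fun x => u0e x ^ 2) Ω)
    (u : (Fin d → ℝ) × ℝ → ℝ)
    (hu : IsSolution d Ω T f B ε u0e u) (n : ℕ) :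
    ε * r * ∫ p in Ω ×ˢ Ioo (0:ℝ) T, deriv (phi n) (u p) * ∑ j, (pdX d u j p) ^ 2
      ≤ (1 / 2) * ∫ x in Ω, (u0e x) ^ 2 := by
  obtain ⟨hBc, -, hr, hBr⟩ := hB
  have hQ : IsOpen (Ω ×ˢ Ioo (0:ℝ) T) := hΩo.prod isOpen_Ioo
  have hclos : closure (Ω ×ˢ Ioo (0:ℝ) T) = closure Ω ×ˢ Icc 0 T := by
    rw [closure_prod_eq, closure_Ioo hT.ne]
  have hScomp : IsCompact (closure (Ω ×ˢ Ioo (0:ℝ) T)) := by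
    rw [hclos]; exact hΩb.isCompact_closure.prod isCompact_Icc
  have hfin : volume (Ω ×ˢ Ioo (0:ℝ) T) ≠ ⊤ :=
    ((measure_mono subset_closure).trans_lt hScomp.measure_lt_top).ne
  obtain ⟨cu, c1, c2, du, d1⟩ := cb_of_contDiffOn hQ subset_closure hScomp hu.smooth
  have ucont : ContinuousOn u (closure Ω ×ˢ Icc 0 T) := hclos ▸ hu.smooth.continuousOn
  have cX : ∀ j, CB (Ω ×ˢ Ioo (0:ℝ) T) (pdX d u j) := fun j => c1 _
  have cXX : ∀ j, CB (Ω ×ˢ Ioo (0:ℝ) T) (pdXX d u j) := fun j => c2 _ _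
  have cT : CB (Ω ×ˢ Ioo (0:ℝ) T) (pdT d u) := c1 _
  have hφ : Continuous (phi n) := (phi_contDiff n).continuous
  have hφ' : Continuous (deriv (phi n)) := (phi_contDiff n).continuous_deriv le_rfl
  have hBcont : Continuous B := hBc.continuous
  have hB' : Continuous (deriv B) := hBc.continuous_deriv (by norm_num)
  have hf' : ∀ j, Continuous (deriv (f j)) := fun j => (hf.1 j).continuous_deriv le_rfl
  have hG : ∀ j, Continuous (prim (deriv (f j)) n) := fun j =>
    continuous_iff_continuousAt.2 fun s => (prim_hasDerivAt (hf' j) n s).continuousAt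
  -- the flux and its divergence
  let W : Fin d → (Fin d → ℝ) × ℝ → ℝ := fun j p =>
    prim (deriv (f j)) n (u p) + (-ε) * (B (u p) * (pdX d u j p * phi n (u p)))
  let WD : Fin d → (Fin d → ℝ) × ℝ → ℝ := fun j p =>
    deriv (f j) (u p) * phi n (u p) * pdX d u j p +
      (-ε) * (deriv B (u p) * pdX d u j p * (pdX d u j p * phi n (u p)) +
        B (u p) * (pdXX d u j p * phi n (u p) +
          pdX d u j p * (deriv (phi n) (u p) * pdX d u j p)))
  have cW : ∀ j, CB (Ω ×ˢ Ioo (0:ℝ) T) (W j) := fun j =>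
    (cu.comp (hG j)).add ((CB.const _).mul ((cu.comp hBcont).mul ((cX j).mul (cu.comp hφ))))
  have cWD : ∀ j, CB (Ω ×ˢ Ioo (0:ℝ) T) (WD j) := fun j =>
    (((cu.comp (hf' j)).mul (cu.comp hφ)).mul (cX j)).add ((CB.const _).mul
      ((((cu.comp hB').mul (cX j)).mul ((cX j).mul (cu.comp hφ))).add
        ((cu.comp hBcont).mul (((cXX j).mul (cu.comp hφ)).add
          ((cX j).mul ((cu.comp hφ').mul (cX j)))))))
  have hline : ∀ j, ∀ t ∈ Ioo (0:ℝ) T, ∀ x ∈ Ω,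
      HasLineDerivAt ℝ (fun x => W j (x, t)) (WD j (x, t)) x (Pi.single j 1) := by
    intro j t ht x hx
    have hp : (x, t) ∈ Ω ×ˢ Ioo (0:ℝ) T := ⟨hx, ht⟩
    have hl : HasDerivAt (fun s : ℝ => ((x + s • (Pi.single j 1 : Fin d → ℝ), t) :
        (Fin d → ℝ) × ℝ)) (Pi.single j 1, 0) 0 := by
      refine HasDerivAt.prodMk ?_ (hasDerivAt_const _ _)
      simpa using ((hasDerivAt_id (0:ℝ)).smul_const (Pi.single j 1 : Fin d → ℝ)).const_add x
    have e0 : ((x + (0:ℝ) • (Pi.single j 1 : Fin d → ℝ), t) : (Fin d → ℝ) × ℝ) = (x, t) := by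
      simp
    have hu1 : HasDerivAt (fun s : ℝ => u (x + s • (Pi.single j 1 : Fin d → ℝ), t))
        (pdX d u j (x, t)) 0 := by
      have h := (du _ hp).hasFDerivAt
      rw [← e0] at h
      have := h.comp_hasDerivAt 0 hl
      rw [e0] at this
      exact this
    have hu2 : HasDerivAt (fun s : ℝ => pdX d u j (x + s • (Pi.single j 1 : Fin d → ℝ), t))
        (pdXX d u j (x, t)) 0 := by
      have h := (d1 (Pi.single j 1, 0) _ hp).hasFDerivAt
      rw [← e0] at h
      have := h.comp_hasDerivAt 0 hl
      rw [e0] at this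
      exact this
    have hcomp : ∀ (F : ℝ → ℝ) (F' : ℝ), HasDerivAt F F' (u (x, t)) →
        HasDerivAt (fun s : ℝ => F (u (x + s • (Pi.single j 1 : Fin d → ℝ), t)))
          (F' * pdX d u j (x, t)) 0 := by
      intro F F' hF
      rw [← e0] at hF
      exact hF.comp (0:ℝ) hu1
    have hBd : HasDerivAt B (deriv B (u (x, t))) (u (x, t)) :=
      (hBc.differentiable (by norm_num) _).hasDerivAt
    have k1 := hcomp _ _ (prim_hasDerivAt (hf' j) n (u (x, t)))
    have k2 := hcomp _ _ hBd
    have k3 := hcomp _ _ (phi_hasDerivAt n (u (x, t)))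
    have k := k1.add ((k2.mul (hu2.mul k3)).const_mul (-ε))
    unfold HasLineDerivAt
    convert! k using 1
    simp only [WD, Pi.mul_apply, e0]
  have hWD0 : ∀ j, ∫ p in Ω ×ˢ Ioo (0:ℝ) T, WD j p = 0 := by
    intro j
    have hi := (cWD j).integrableOn hQ hfin
    rw [Measure.volume_eq_prod, IntegrableOn, ← Measure.prod_restrict] at hi
    rw [Measure.volume_eq_prod, ← Measure.prod_restrict, integral_prod_symm _ hi]
    refine setIntegral_eq_zero_of_forall_eq_zero fun t ht => ?_
    have hmap : MapsTo (fun x : Fin d → ℝ => (x, t)) Ω (Ω ×ˢ Ioo (0:ℝ) T) :=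
      fun x hx => ⟨hx, ht⟩
    refine integral_deriv_zero hΩo hΩb
      ((cW j).comp_left (F := fun x : Fin d → ℝ => (x, t)) (by fun_prop) hmap)
      ((cWD j).comp_left (F := fun x : Fin d → ℝ => (x, t)) (by fun_prop) hmap)
      (Pi.single j 1) (hline j t ht) ?_
    intro x hx
    have hc : ContinuousWithinAt (fun y : Fin d → ℝ => u (y, t)) Ω x := by
      have := ucont (x, t) ⟨frontier_subset_closure hx, Ioo_subset_Icc_self ht⟩
      exact this.comp (f := fun y : Fin d → ℝ => (y, t)) (by fun_prop : Continuous _).continuousWithinAt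
        (fun y hy => ⟨subset_closure hy, Ioo_subset_Icc_self ht⟩)
    have hc2 : Tendsto (fun y : Fin d → ℝ => (n:ℝ) * u (y, t) ^ 2) (𝓝[Ω] x) (𝓝 (n * 0 ^ 2)) := by
      rw [← hu.bdry x hx t ht]
      exact (hc.pow 2).const_mul _
    filter_upwards [hc2.eventually_lt_const (u := 1) (by simp)] with y hy
    simp only [W, phi_eq_zero hy.le, prim_eq_zero hy.le]
    simp
  -- pointwise identity
  have hid : ∀ p ∈ Ω ×ˢ Ioo (0:ℝ) T,
      ε * (B (u p) * (deriv (phi n) (u p) * ∑ j, pdX d u j p ^ 2))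
        = - (phi n (u p) * pdT d u p) - ∑ j, WD j p := by
    rintro ⟨x, t⟩ ⟨hx, ht⟩
    have hpde := hu.pde x hx t ht
    have hsum : ∑ j, WD j (x, t) =
        phi n (u (x, t)) * ∑ j, deriv (f j) (u (x, t)) * pdX d u j (x, t)
        - ε * (phi n (u (x, t)) * (deriv B (u (x, t)) * ∑ j, pdX d u j (x, t) ^ 2
            + B (u (x, t)) * lapX d u (x, t))
          + B (u (x, t)) * (deriv (phi n) (u (x, t)) * ∑ j, pdX d u j (x, t) ^ 2)) := by
      unfold lapX
      simp only [Finset.mul_sum, ← Finset.sum_add_distrib, ← Finset.sum_sub_distrib]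
      refine Finset.sum_congr rfl fun j _ => ?_
      simp only [WD]
      ring
    rw [hsum]
    linear_combination (phi n (u (x, t))) * hpde
  -- integrability
  have cS : CB (Ω ×ˢ Ioo (0:ℝ) T) (fun p => ∑ j, pdX d u j p ^ 2) := by
    refine ⟨continuousOn_finsetSum _ fun j _ => (cX j).1.pow 2, ?_⟩
    choose C hC using fun j => (cX j).2
    refine ⟨∑ j, C j ^ 2, fun p hp => ?_⟩
    rw [abs_of_nonneg (Finset.sum_nonneg fun j _ => sq_nonneg _)]
    exact Finset.sum_le_sum fun j _ => sq_le_sq' (abs_le.1 (hC j p hp)).1 (abs_le.1 (hC j p hp)).2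
  have cφS := (cu.comp hφ').mul cS
  have hiφS := cφS.integrableOn (μ := volume) hQ hfin
  have hiBφS := ((cu.comp hBcont).mul cφS).integrableOn (μ := volume) hQ hfin
  have cφT := (cu.comp hφ).mul cT
  have hiφT := cφT.integrableOn (μ := volume) hQ hfin
  -- the time term
  have htime : - ((1 / 2) * ∫ x in Ω, u0e x ^ 2)
      ≤ ∫ p in Ω ×ˢ Ioo (0:ℝ) T, phi n (u p) * pdT d u p := by
    have hi := hiφT
    rw [Measure.volume_eq_prod, IntegrableOn, ← Measure.prod_restrict] at hi
    rw [Measure.volume_eq_prod, ← Measure.prod_restrict, integral_prod _ hi,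
      ← integral_const_mul, ← integral_neg]
    refine setIntegral_mono_on (hu0sq.const_mul (1/2)).neg hi.integral_prod_left
      hΩo.measurableSet fun x hx => ?_
    have hmap : MapsTo (fun t : ℝ => (x, t)) (Ioo 0 T) (Ω ×ˢ Ioo (0:ℝ) T) :=
      fun t ht => ⟨hx, ht⟩
    have hΦd : ∀ s, HasDerivAt (prim (fun _ => 1) n) (phi n s) s := fun s => by
      simpa using prim_hasDerivAt (c := fun _ => 1) continuous_const n s
    have hΦc : Continuous (prim (fun _ => 1) n) :=
      continuous_iff_continuousAt.2 fun s => (hΦd s).continuousAt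
    have hux : ContinuousOn (fun t : ℝ => u (x, t)) (Icc 0 T) :=
      ucont.comp (f := fun t : ℝ => (x, t)) (by fun_prop : Continuous _).continuousOn
        (fun t ht => ⟨subset_closure hx, ht⟩)
    have hF := intervalIntegral.integral_eq_sub_of_hasDerivAt_of_le hT.le
      (f := fun t => prim (fun _ => 1) n (u (x, t)))
      (f' := fun t => phi n (u (x, t)) * pdT d u (x, t))
      (hΦc.comp_continuousOn hux) (fun t ht => by
        have hl : HasDerivAt (fun s : ℝ => ((x, s) : (Fin d → ℝ) × ℝ)) (0, 1) t :=
          (hasDerivAt_const _ _).prodMk (hasDerivAt_id t)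
        have h1 : HasDerivAt (fun s => u (x, s)) (pdT d u (x, t)) t :=
          (du (x, t) ⟨hx, ht⟩).hasFDerivAt.comp_hasDerivAt t hl
        exact (hΦd _).comp t h1)
      (by
        rw [intervalIntegrable_iff_integrableOn_Ioo_of_le hT.le]
        exact (cφT.comp_left (F := fun t : ℝ => (x, t)) (by fun_prop) hmap).integrableOn
          isOpen_Ioo (by simp))
    rw [intervalIntegral.integral_of_le hT.le, integral_Ioc_eq_integral_Ioo] at hF
    rw [hF, hu.init x hx]
    have b1 := (prim_one_bounds n (u (x, T))).1
    have b2 := (prim_one_bounds n (u0e x)).2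
    linarith
  -- conclusion
  have hmain : ∫ p in Ω ×ˢ Ioo (0:ℝ) T,
      ε * (B (u p) * (deriv (phi n) (u p) * ∑ j, pdX d u j p ^ 2))
      = - ∫ p in Ω ×ˢ Ioo (0:ℝ) T, phi n (u p) * pdT d u p := by
    have hneg : IntegrableOn (fun p => -(phi n (u p) * pdT d u p)) (Ω ×ˢ Ioo (0:ℝ) T) volume :=
      hiφT.neg
    rw [setIntegral_congr_fun hQ.measurableSet hid, integral_sub hneg
      (integrable_finsetSum _ fun j _ => (cWD j).integrableOn hQ hfin), integral_neg,
      integral_finsetSum _ fun j _ => (cWD j).integrableOn hQ hfin]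
    simp [hWD0]
  rw [← integral_const_mul]
  calc _ ≤ ∫ p in Ω ×ˢ Ioo (0:ℝ) T,
      ε * (B (u p) * (deriv (phi n) (u p) * ∑ j, pdX d u j p ^ 2)) := by
        refine setIntegral_mono_on (hiφS.const_mul _) (hiBφS.const_mul _) hQ.measurableSet
          fun p _ => ?_
        rw [mul_assoc]
        have : 0 ≤ deriv (phi n) (u p) * ∑ j, pdX d u j p ^ 2 :=
          mul_nonneg (phi_deriv_nonneg _ _) (Finset.sum_nonneg fun j _ => sq_nonneg _)
        exact mul_le_mul_of_nonneg_left (mul_le_mul_of_nonneg_right (hBr _) this) hε.le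
    _ ≤ _ := by rw [hmain]; linarith

/-- energy estimate for the regularized viscosity problem with smooth
compactly supported initial data bounded by `A`:
`ε ∑_j ∫_{Ω_T} |∂u^ε/∂x_j|² ≤ (1/(2r)) ‖u_{0ε}‖²_{L²(Ω)} ≤ (1/(2r)) Vol(Ω) A²`. -/
theorem stmt3 (d : ℕ) (Ω : Set (Fin d → ℝ)) (hΩo : IsOpen Ω)
    (hΩb : Bornology.IsBounded Ω) (T : ℝ) (hT : 0 < T)
    (f : Fin d → ℝ → ℝ) (hf : FluxOK d f)
    (B : ℝ → ℝ) (r : ℝ) (hB : DiffusionOK B r)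
    (ε : ℝ) (hε : 0 < ε)
    (u0e : (Fin d → ℝ) → ℝ) (hsm : ContDiff ℝ (⊤ : ℕ∞) u0e)
    (hcs : HasCompactSupport u0e) (hss : tsupport u0e ⊆ Ω)
    (A : ℝ) (hA : 0 < A) (hbd : ∀ x, |u0e x| ≤ A)
    (u : (Fin d → ℝ) × ℝ → ℝ)
    (hu : IsSolution d Ω T f B ε u0e u) :
    ε * ∑ j, ∫ p in Ω ×ˢ Ioo (0:ℝ) T, (pdX d u j p) ^ 2
        ≤ (1 / (2 * r)) * ∫ x in Ω, (u0e x) ^ 2 ∧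
    (1 / (2 * r)) * (∫ x in Ω, (u0e x) ^ 2)
        ≤ (1 / (2 * r)) * (volume Ω).toReal * A ^ 2 := by
  have hu0sq : IntegrableOn (fun x => u0e x ^ 2) Ω := by
    refine (CB.integrableOn (Q := Ω) (g := fun x => u0e x ^ 2) ?_ hΩo hΩb.measure_lt_top.ne)
    refine ⟨(hsm.continuous.pow 2).continuousOn, A ^ 2, fun x _ => ?_⟩
    rw [abs_pow]
    exact pow_le_pow_left₀ (abs_nonneg _) (hbd x) 2
  have hr : 0 < r := hB.2.2.1
  constructor
  · have hQ : IsOpen (Ω ×ˢ Ioo (0:ℝ) T) := hΩo.prod isOpen_Ioo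
    have hclos : closure (Ω ×ˢ Ioo (0:ℝ) T) = closure Ω ×ˢ Icc 0 T := by
      rw [closure_prod_eq, closure_Ioo hT.ne]
    have hScomp : IsCompact (closure (Ω ×ˢ Ioo (0:ℝ) T)) := by
      rw [hclos]; exact hΩb.isCompact_closure.prod isCompact_Icc
    have hfin : volume (Ω ×ˢ Ioo (0:ℝ) T) ≠ ⊤ :=
      ((measure_mono subset_closure).trans_lt hScomp.measure_lt_top).ne
    obtain ⟨cu, c1, -, du, -⟩ := cb_of_contDiffOn hQ subset_closure hScomp hu.smooth
    have cX2 : ∀ j, CB (Ω ×ˢ Ioo (0:ℝ) T) (fun p => pdX d u j p ^ 2) := fun j =>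
      (c1 _).comp (F := fun s => s ^ 2) (by fun_prop)
    have hi : ∀ j, IntegrableOn (fun p => pdX d u j p ^ 2) (Ω ×ˢ Ioo (0:ℝ) T) volume :=
      fun j => (cX2 j).integrableOn hQ hfin
    have hiS : IntegrableOn (fun p => ∑ j, pdX d u j p ^ 2) (Ω ×ˢ Ioo (0:ℝ) T) volume :=
      integrable_finsetSum _ fun j _ => hi j
    have hnn : ∀ p, 0 ≤ ∑ j, pdX d u j p ^ 2 := fun p => Finset.sum_nonneg fun j _ => sq_nonneg _
    let s : ℕ → Set ((Fin d → ℝ) × ℝ) := fun n =>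
      (Ω ×ˢ Ioo (0:ℝ) T) ∩ {p | 2 ≤ (n:ℝ) * u p ^ 2}
    have hsQ : ∀ n, s n ⊆ Ω ×ˢ Ioo (0:ℝ) T := fun n => inter_subset_left
    have hsm' : ∀ n, MeasurableSet (s n) := by
      intro n
      have hO : IsOpen ((Ω ×ˢ Ioo (0:ℝ) T) ∩ (fun p => (n:ℝ) * u p ^ 2) ⁻¹' Iio 2) :=
        (continuousOn_const.mul (cu.1.pow 2)).isOpen_inter_preimage hQ isOpen_Iio
      have : s n = (Ω ×ˢ Ioo (0:ℝ) T) \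
          ((Ω ×ˢ Ioo (0:ℝ) T) ∩ (fun p => (n:ℝ) * u p ^ 2) ⁻¹' Iio 2) := by
        ext p
        by_cases hp : p ∈ Ω ×ˢ Ioo (0:ℝ) T
        · simp only [s, mem_inter_iff, hp, true_and, Set.mem_sdiff, mem_preimage, mem_Iio, not_lt]
          rfl
        · simp only [s, mem_inter_iff, hp, false_and, Set.mem_sdiff]
      rw [this]
      exact hQ.measurableSet.diff hO.measurableSet
    have hmono : Monotone s := by
      intro m n hmn p hp
      have h2 : 2 ≤ (m:ℝ) * u p ^ 2 := hp.2
      refine ⟨hp.1, ?_⟩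
      rw [mem_ofPred_eq]
      refine le_trans h2 ?_
      exact mul_le_mul_of_nonneg_right (by exact_mod_cast hmn) (sq_nonneg _)
    have hsub : (⋃ n, s n) ⊆ Ω ×ˢ Ioo (0:ℝ) T := iUnion_subset hsQ
    have hlim := tendsto_setIntegral_of_monotone (μ := volume) hsm' hmono (hiS.mono_set hsub)
    have hUnion : ∫ p in ⋃ n, s n, ∑ j, pdX d u j p ^ 2
        = ∫ p in Ω ×ˢ Ioo (0:ℝ) T, ∑ j, pdX d u j p ^ 2 := by
      symm
      refine setIntegral_eq_of_subset_of_ae_sdiff_eq_zero hQ.measurableSet.nullMeasurableSet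
        hsub ?_
      have hae : ∀ᵐ p : (Fin d → ℝ) × ℝ, ∀ j, p ∈ Ω ×ˢ Ioo (0:ℝ) T → u p = 0 →
          pdX d u j p = 0 :=
        ae_all_iff.2 fun j => ae_fderiv_zero_of_zero hQ cu.1 du _
      filter_upwards [hae] with p hp hpd
      have hu0 : u p = 0 := by
        by_contra hne
        apply hpd.2
        obtain ⟨n, hn⟩ := exists_nat_ge (2 / u p ^ 2)
        refine mem_iUnion.2 ⟨n, hpd.1, ?_⟩
        have : 0 < u p ^ 2 := by positivity
        exact (div_le_iff₀ this).1 hn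
      exact Finset.sum_eq_zero fun j _ => by rw [hp j hpd.1 hu0]; simp
    rw [hUnion] at hlim
    have hle : ∀ n, ε * r * ∫ p in s n, ∑ j, pdX d u j p ^ 2
        ≤ (1 / 2) * ∫ x in Ω, (u0e x) ^ 2 := by
      intro n
      refine le_trans ?_ (energy_trunc d Ω hΩo hΩb T hT f hf B r hB ε hε u0e hu0sq u hu n)
      refine mul_le_mul_of_nonneg_left ?_ (by positivity)
      have hφ' : Continuous (deriv (phi n)) := (phi_contDiff n).continuous_deriv le_rfl
      have hnn2 : ∀ p, 0 ≤ deriv (phi n) (u p) * ∑ j, pdX d u j p ^ 2 := fun p =>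
        mul_nonneg (phi_deriv_nonneg _ _) (hnn p)
      have hiφ : IntegrableOn (fun p => deriv (phi n) (u p) * ∑ j, pdX d u j p ^ 2)
          (Ω ×ˢ Ioo (0:ℝ) T) volume := by
        simp only [Finset.mul_sum]
        exact integrable_finsetSum _ fun j _ =>
          ((cu.comp hφ').mul (cX2 j)).integrableOn hQ hfin
      calc _ ≤ ∫ p in s n, deriv (phi n) (u p) * ∑ j, pdX d u j p ^ 2 := by
            refine setIntegral_mono_on (hiS.mono_set (hsQ n)) (hiφ.mono_set (hsQ n)) (hsm' n)
              fun p hp => ?_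
            exact le_mul_of_one_le_left (hnn p) (phi_deriv_ge_one hp.2)
        _ ≤ _ := setIntegral_mono_set hiφ (Eventually.of_forall hnn2)
            (hsQ n).eventuallyLE
    have hfinal : ε * r * ∫ p in Ω ×ˢ Ioo (0:ℝ) T, ∑ j, pdX d u j p ^ 2
        ≤ (1 / 2) * ∫ x in Ω, (u0e x) ^ 2 :=
      le_of_tendsto' (hlim.const_mul _) hle
    rw [← integral_finsetSum _ fun j _ => hi j]
    have h2 : (1 / (2 * r)) * ∫ x in Ω, (u0e x) ^ 2
        = ((1 / 2) * ∫ x in Ω, (u0e x) ^ 2) / r := by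
      field_simp
    rw [h2, le_div_iff₀ hr]
    linarith
  · rw [mul_assoc]
    refine mul_le_mul_of_nonneg_left ?_ (by positivity)
    have h1 : ∫ x in Ω, (u0e x) ^ 2 ≤ ∫ x in Ω, A ^ 2 := by
      refine setIntegral_mono_on hu0sq (integrableOn_const hΩb.measure_lt_top.ne)
        hΩo.measurableSet fun x _ => ?_
      rw [← sq_abs]
      exact pow_le_pow_left₀ (abs_nonneg _) (hbd x) 2
    rw [setIntegral_const, smul_eq_mul] at h1
    exact h1

end
end

section
/- Let Ω be a bounded open subset of ℝ^d, T > 0 and Ω_T = Ω × (0,T). Let f : ℝ → ℝ^d be C¹ with bounded derivative, let B : ℝ → ℝ be C³ and bounded with B(s) ≥ r > 0 for all s ∈ ℝ. Let M > 0, let (ε_k) be a sequence of positive reals with ε_k → 0, and for each k let u^{ε_k} ∈ C²(closure(Ω_T)) satisfy ∂_t u^{ε_k} + ∇·(f(u^{ε_k})) = ε_k ∇·(B(u^{ε_k}) ∇u^{ε_k}) pointwise in Ω_T, u^{ε_k} = 0 on ∂Ω × (0,T), with sup_{Ω_T} |u^{ε_k}| ≤ M for all k and ε_k ∫_{Ω_T}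 |∇_x u^{ε_k}|² dx dt ≤ M for all k. Suppose u^{ε_k} → u almost everywhere in Ω_T for some measurable function u. Then u satisfies the Kruzhkov entropy inequalities in the interior: for every k ∈ ℝ and every nonnegative φ ∈ C_c^∞(Ω × (0,T)), ∫_{Ω_T} ( |u − k| ∂_t φ + sgn(u − k) (f(u) − f(k)) · ∇_x φ ) dx dt ≥ 0, where sgn(s) = 1 if s > 0, 0 if s = 0, and −1 if s < 0. -/
open MeasureTheory Set Filter Topology

noncomputable section

section helpers

variable {E : Type*} [NormedAddCommGroup E] [NormedSpace ℝ E] [FiniteDimensional ℝ E]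
  [MeasurableSpace E] [BorelSpace E] {μ : Measure E} [μ.IsAddHaarMeasure]

theorem aux_int_mul {U : Set E} (hU : IsOpen U) {g φ : E → ℝ} (hg : ContinuousOn g U)
    (hφ : Continuous φ) (hc : HasCompactSupport φ) (hs : tsupport φ ⊆ U) :
    Integrable (fun x => g x * φ x) μ := by
  have hcont : Continuous (fun x => g x * φ x) := by
    apply continuous_of_tsupport
    intro x hx
    have hx' : x ∈ tsupport φ := tsupport_mul_subset_right hx
    exact (hg.continuousAt (hU.mem_nhds (hs hx'))).mul hφ.continuousAt
  exact hcont.integrable_of_hasCompactSupport hc.mul_left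

theorem aux_ibp {U : Set E} (hU : IsOpen U) {g φ : E → ℝ} (hg : ContDiffOn ℝ 1 g U)
    (hφ : ContDiff ℝ 1 φ) (hc : HasCompactSupport φ) (hs : tsupport φ ⊆ U) (e : E) :
    ∫ x, g x * fderiv ℝ φ x e ∂μ = - ∫ x, fderiv ℝ g x e * φ x ∂μ := by
  apply integral_mul_fderiv_eq_neg_fderiv_mul_of_integrable
  · refine aux_int_mul hU ?_ hφ.continuous hc hs
    exact (hg.continuousOn_fderiv_of_isOpen hU le_rfl).clm_apply continuousOn_const
  · refine aux_int_mul hU hg.continuousOn ?_ (hc.fderiv_apply ℝ e)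
      ((tsupport_fderiv_apply_subset ℝ e).trans hs)
    exact (hφ.continuous_fderiv one_ne_zero).clm_apply continuous_const
  · exact aux_int_mul hU hg.continuousOn hφ.continuous hc hs
  · intro x hx
    exact (hg.contDiffAt (hU.mem_nhds (hs hx))).differentiableAt one_ne_zero
  · intro x _
    exact hφ.differentiable one_ne_zero x

end helpers

/-- primitive of `a * g` vanishing at `c` -/
def auxP (a : ℝ → ℝ) (c : ℝ) (g : ℝ → ℝ) (s : ℝ) : ℝ := ∫ τ in c..s, a τ * g τ

theorem auxP_hasDerivAt {a g : ℝ → ℝ} (c : ℝ) (ha : Continuous a) (hg : Continuous g) (s : ℝ) :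
    HasDerivAt (auxP a c g) (a s * g s) s :=
  intervalIntegral.integral_hasDerivAt_right ((ha.mul hg).intervalIntegrable _ _)
    ((ha.mul hg).stronglyMeasurableAtFilter _ _) (ha.mul hg).continuousAt

theorem auxP_deriv {a g : ℝ → ℝ} (c : ℝ) (ha : Continuous a) (hg : Continuous g) :
    deriv (auxP a c g) = fun s => a s * g s :=
  funext fun s => (auxP_hasDerivAt c ha hg s).deriv

theorem auxP_contDiff_one {a g : ℝ → ℝ} (c : ℝ) (ha : Continuous a) (hg : Continuous g) :
    ContDiff ℝ 1 (auxP a c g) := by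
  rw [contDiff_one_iff_deriv]
  refine ⟨fun s => (auxP_hasDerivAt c ha hg s).differentiableAt, ?_⟩
  rw [auxP_deriv c ha hg]
  exact ha.mul hg

theorem auxP_contDiff_two {a g : ℝ → ℝ} (c : ℝ) (ha : ContDiff ℝ 1 a) (hg : ContDiff ℝ 1 g) :
    ContDiff ℝ 2 (auxP a c g) := by
  rw [show (2 : WithTop ℕ∞) = 1 + 1 by norm_num, contDiff_succ_iff_deriv]
  refine ⟨fun s => (auxP_hasDerivAt c ha.continuous hg.continuous s).differentiableAt,
    by simp, ?_⟩
  rw [auxP_deriv c ha.continuous hg.continuous]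
  exact ha.mul hg

theorem auxP_bound {a g : ℝ → ℝ} (c : ℝ) {C : ℝ} (ha : ∀ s, |a s| ≤ 1) (hg : ∀ s, |g s| ≤ C)
    (s : ℝ) : |auxP a c g s| ≤ C * |s - c| := by
  unfold auxP
  rw [← Real.norm_eq_abs]
  apply intervalIntegral.norm_integral_le_of_norm_le_const
  intro x _
  rw [Real.norm_eq_abs, abs_mul]
  calc |a x| * |g x| ≤ 1 * |g x| := by gcongr; exact ha x
    _ ≤ C := by simpa using hg x

/-- smooth approximation of the sign -/
def auxA (c : ℝ) (n : ℕ) (s : ℝ) : ℝ := 2 / Real.pi * Real.arctan ((n + 1 : ℝ) * (s - c))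

theorem auxA_contDiff (c : ℝ) (n : ℕ) : ContDiff ℝ 1 (auxA c n) := by
  unfold auxA
  exact contDiff_const.mul (Real.contDiff_arctan.comp (by fun_prop))

theorem auxA_abs (c : ℝ) (n : ℕ) (s : ℝ) : |auxA c n s| ≤ 1 := by
  unfold auxA
  have h1 := Real.arctan_lt_pi_div_two ((n + 1 : ℝ) * (s - c))
  have h2 := Real.neg_pi_div_two_lt_arctan ((n + 1 : ℝ) * (s - c))
  have hp := Real.pi_pos
  rw [abs_mul, abs_of_pos (by positivity), div_mul_eq_mul_div, div_le_one hp]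
  have : |Real.arctan ((n + 1 : ℝ) * (s - c))| ≤ Real.pi / 2 := abs_le.2 ⟨h2.le, h1.le⟩
  linarith

theorem auxA_deriv_nonneg (c : ℝ) (n : ℕ) (s : ℝ) : 0 ≤ deriv (auxA c n) s := by
  have hm : Monotone (auxA c n) := by
    intro x y hxy
    unfold auxA
    have := Real.pi_pos
    apply mul_le_mul_of_nonneg_left _ (by positivity)
    apply Real.arctan_mono
    gcongr
  exact hm.deriv_nonneg

theorem auxA_tendsto (c s : ℝ) :
    Tendsto (fun n => auxA c n s) atTop (𝓝 (Real.sign (s - c))) := by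
  have hn : Tendsto (fun n : ℕ => (n + 1 : ℝ)) atTop atTop :=
    tendsto_atTop_add_const_right _ _ tendsto_natCast_atTop_atTop
  have hp := Real.pi_pos
  rcases lt_trichotomy (s - c) 0 with h | h | h
  · rw [Real.sign_of_neg h]
    have h1 : Tendsto (fun n : ℕ => (n + 1 : ℝ) * (s - c)) atTop atBot :=
      hn.atTop_mul_const_of_neg h
    have h2 := (tendsto_nhds_of_tendsto_nhdsWithin Real.tendsto_arctan_atBot).comp h1
    have h3 := h2.const_mul (2 / Real.pi)
    rw [show 2 / Real.pi * -(Real.pi / 2) = -1 by field_simp] at h3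
    exact h3
  · simp [auxA, h]
  · rw [Real.sign_of_pos h]
    have h1 : Tendsto (fun n : ℕ => (n + 1 : ℝ) * (s - c)) atTop atTop :=
      hn.atTop_mul_const h
    have h2 := (tendsto_nhds_of_tendsto_nhdsWithin Real.tendsto_arctan_atTop).comp h1
    have h3 := h2.const_mul (2 / Real.pi)
    rw [show 2 / Real.pi * (Real.pi / 2) = 1 by field_simp] at h3
    exact h3

theorem auxP_tendsto (c : ℝ) {F : ℝ → ℝ} (hF : ContDiff ℝ 1 F) {C : ℝ}
    (hC : ∀ s, |deriv F s| ≤ C) (s : ℝ) :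
    Tendsto (fun n => auxP (auxA c n) c (deriv F) s) atTop
      (𝓝 (Real.sign (s - c) * (F s - F c))) := by
  have hFc : Continuous (deriv F) := hF.continuous_deriv le_rfl
  have key : Real.sign (s - c) * (F s - F c)
      = ∫ τ in c..s, Real.sign (s - c) * deriv F τ := by
    rw [intervalIntegral.integral_const_mul, intervalIntegral.integral_deriv_eq_sub
      (fun x _ => hF.differentiable one_ne_zero x) (hFc.intervalIntegrable _ _)]
  rw [key]
  apply intervalIntegral.tendsto_integral_filter_of_dominated_convergence (fun _ => C)
  · exact Eventually.of_forall fun n =>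
      ((auxA_contDiff c n).continuous.mul hFc).aestronglyMeasurable
  · refine Eventually.of_forall fun n => Eventually.of_forall fun x _ => ?_
    rw [Real.norm_eq_abs, abs_mul]
    calc _ ≤ 1 * |deriv F x| := by gcongr; exact auxA_abs c n x
      _ ≤ C := by simpa using hC x
  · exact intervalIntegrable_const
  · have hne : ∀ᵐ x : ℝ, x ≠ s := by simp [ae_iff, measure_singleton]
    have hne' : ∀ᵐ x : ℝ, x ≠ c := by simp [ae_iff, measure_singleton]
    filter_upwards [hne, hne'] with x hx hx' hm
    have : Real.sign (s - c) = Real.sign (x - c) := by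
      rcases le_total c s with h | h
      · rw [uIoc_of_le h] at hm
        rw [Real.sign_of_pos (by linarith [hm.1, hm.2]), Real.sign_of_pos (by linarith [hm.1])]
      · rw [uIoc_of_ge h] at hm
        have : x < c := lt_of_le_of_ne hm.2 hx'
        rw [Real.sign_of_neg (by linarith [hm.1]), Real.sign_of_neg (by linarith)]
    rw [this]
    exact (auxA_tendsto c x).mul_const _

/-- dominated convergence in the form needed -/
theorem aux_dct {α : Type*} [MeasurableSpace α] {μ : Measure α} {G : ℕ → α → ℝ} {g ψ : α → ℝ}
    (C : ℝ) (hG : ∀ n, AEStronglyMeasurable (G n) μ) (hb : ∀ n, ∀ᵐ p ∂μ, |G n p| ≤ C)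
    (hψ : Integrable ψ μ) (hl : ∀ᵐ p ∂μ, Tendsto (fun n => G n p) atTop (𝓝 (g p))) :
    Tendsto (fun n => ∫ p, G n p * ψ p ∂μ) atTop (𝓝 (∫ p, g p * ψ p ∂μ)) := by
  apply tendsto_integral_of_dominated_convergence (fun p => C * |ψ p|)
  · exact fun n => (hG n).mul hψ.1
  · exact hψ.abs.const_mul C
  · intro n
    filter_upwards [hb n] with p hp
    rw [Real.norm_eq_abs, abs_mul]
    gcongr
  · filter_upwards [hl] with p hp
    exact hp.mul_const _

/-- chain rule for a scalar function -/
theorem aux_chain {E : Type*} [NormedAddCommGroup E] [NormedSpace ℝ E] {h : ℝ → ℝ} {h' : ℝ}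
    {w : E → ℝ} {p : E} (hh : HasDerivAt h h' (w p)) (hw : DifferentiableAt ℝ w p) (e : E) :
    fderiv ℝ (fun x => h (w x)) p e = h' * fderiv ℝ w p e := by
  have := (hh.comp_hasFDerivAt p hw.hasFDerivAt).fderiv
  rw [show (fun x => h (w x)) = h ∘ w from rfl, this]
  simp

/-- pointwise entropy inequality -/
theorem aux_pointwise (d : ℕ) {U : Set ((Fin d → ℝ) × ℝ)} (hU : IsOpen U)
    {f : Fin d → ℝ → ℝ} (hf : ∀ j, ContDiff ℝ 1 (f j)) {B a : ℝ → ℝ} (hB : ContDiff ℝ 1 B)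
    (hB0 : ∀ s, 0 ≤ B s) (ha : ContDiff ℝ 1 a) (ha' : ∀ s, 0 ≤ deriv a s) (c : ℝ)
    {ε : ℝ} (hε : 0 < ε) {w : (Fin d → ℝ) × ℝ → ℝ} (hw : ContDiffOn ℝ 2 w U)
    {p : (Fin d → ℝ) × ℝ} (hp : p ∈ U)
    (hpde : pdT d w p + ∑ j, deriv (f j) (w p) * pdX d w j p
        = ε * (B (w p) * lapX d w p + deriv B (w p) * ∑ j, pdX d w j p ^ 2)) :
    pdT d (fun x => auxP a c (deriv fun s => s) (w x)) p
      + ∑ j, pdX d (fun x => auxP a c (deriv (f j)) (w x)) j p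
      ≤ ε * ∑ j, pdXX d (fun x => auxP a c B (w x)) j p := by
  have hUn := hU.mem_nhds hp
  have hwd : ∀ x ∈ U, DifferentiableAt ℝ w x := fun x hx =>
    (hw.contDiffAt (hU.mem_nhds hx)).differentiableAt two_ne_zero
  have hid : (deriv fun s : ℝ => s) = fun _ => 1 := by funext s; simp
  have h1 : pdT d (fun x => auxP a c (deriv fun s => s) (w x)) p = a (w p) * pdT d w p := by
    unfold pdT
    rw [hid, aux_chain (auxP_hasDerivAt c ha.continuous continuous_const _) (hwd p hp), mul_one]
  have h2 : ∀ j, pdX d (fun x => auxP a c (deriv (f j)) (w x)) j p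
      = a (w p) * (deriv (f j) (w p) * pdX d w j p) := by
    intro j
    unfold pdX
    rw [aux_chain (auxP_hasDerivAt c ha.continuous ((hf j).continuous_deriv le_rfl) _)
      (hwd p hp), mul_assoc]
  have h3 : ∀ j, pdXX d (fun x => auxP a c B (w x)) j p
      = a (w p) * (B (w p) * pdXX d w j p) + a (w p) * (deriv B (w p) * pdX d w j p ^ 2)
        + deriv a (w p) * B (w p) * pdX d w j p ^ 2 := by
    intro j
    have he : pdX d (fun x => auxP a c B (w x)) j
        =ᶠ[𝓝 p] fun x => (fun s => a s * B s) (w x) * pdX d w j x := by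
      filter_upwards [hUn] with x hx
      unfold pdX
      rw [aux_chain (auxP_hasDerivAt c ha.continuous hB.continuous _) (hwd x hx)]
    have hXd : DifferentiableAt ℝ (pdX d w j) p := by
      have : ContDiffAt ℝ 1 (fderiv ℝ w) p :=
        (hw.contDiffAt hUn).fderiv_right (by norm_num)
      exact (this.differentiableAt one_ne_zero).clm_apply (differentiableAt_const _)
    have hab : HasDerivAt (fun s => a s * B s)
        (deriv a (w p) * B (w p) + a (w p) * deriv B (w p)) (w p) :=
      (ha.differentiable one_ne_zero _).hasDerivAt.mul
        (hB.differentiable one_ne_zero _).hasDerivAt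
    have habd : DifferentiableAt ℝ (fun x => (fun s => a s * B s) (w x)) p :=
      hab.differentiableAt.comp p (hwd p hp)
    unfold pdXX
    rw [he.fderiv_eq, fderiv_fun_mul habd hXd]
    have := aux_chain hab (hwd p hp) (Pi.single j 1, 0)
    simp only [add_apply, smul_apply, smul_eq_mul]
    rw [this]
    change _ = _
    have hx : fderiv ℝ w p (Pi.single j 1, 0) = pdX d w j p := rfl
    rw [hx]
    ring
  rw [h1]
  simp only [h2, h3]
  rw [← Finset.mul_sum, ← mul_add, hpde, Finset.sum_add_distrib, Finset.sum_add_distrib,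
    ← Finset.mul_sum, ← Finset.mul_sum, ← Finset.mul_sum, ← Finset.mul_sum, ← Finset.mul_sum]
  have : 0 ≤ deriv a (w p) * B (w p) * ∑ j, pdX d w j p ^ 2 :=
    mul_nonneg (mul_nonneg (ha' _) (hB0 _)) (Finset.sum_nonneg fun j _ => sq_nonneg _)
  have h4 := mul_nonneg hε.le this
  unfold lapX
  nlinarith [h4]

/-- entropy inequality at the viscous level -/
theorem aux_visc (d : ℕ) {U : Set ((Fin d → ℝ) × ℝ)} (hU : IsOpen U)
    {f : Fin d → ℝ → ℝ} (hf : ∀ j, ContDiff ℝ 1 (f j)) {B a : ℝ → ℝ} (hB : ContDiff ℝ 1 B)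
    (hB0 : ∀ s, 0 ≤ B s) (ha : ContDiff ℝ 1 a) (ha' : ∀ s, 0 ≤ deriv a s) (c : ℝ)
    {ε : ℝ} (hε : 0 < ε) {w : (Fin d → ℝ) × ℝ → ℝ} (hw : ContDiffOn ℝ 2 w U)
    (hpde : ∀ p ∈ U, pdT d w p + ∑ j, deriv (f j) (w p) * pdX d w j p
        = ε * (B (w p) * lapX d w p + deriv B (w p) * ∑ j, pdX d w j p ^ 2))
    {φ : (Fin d → ℝ) × ℝ → ℝ} (hφ : ContDiff ℝ (⊤ : ℕ∞) φ) (hc : HasCompactSupport φ)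
    (hs : tsupport φ ⊆ U) (h0 : ∀ p, 0 ≤ φ p) :
    0 ≤ (∫ p, auxP a c (deriv fun s => s) (w p) * pdT d φ p)
      + (∑ j, ∫ p, auxP a c (deriv (f j)) (w p) * pdX d φ j p)
      + ε * ∑ j, ∫ p, auxP a c B (w p) * pdXX d φ j p := by
  have hw1 : ContDiffOn ℝ 1 w U := hw.of_le (by norm_num)
  have hφ1 : ContDiff ℝ 1 φ := hφ.of_le (by exact_mod_cast le_top)
  have hφ2 : ContDiff ℝ 2 φ := contDiff_infty.1 hφ 2
  have hid : Continuous (deriv fun s : ℝ => s) := by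
    rw [show (deriv fun s : ℝ => s) = fun _ => 1 by funext s; simp]; exact continuous_const
  have c1 : ContDiffOn ℝ 1 (fun x => auxP a c (deriv fun s => s) (w x)) U :=
    (auxP_contDiff_one c ha.continuous hid).comp_contDiffOn hw1
  have c2 : ∀ j, ContDiffOn ℝ 1 (fun x => auxP a c (deriv (f j)) (w x)) U := fun j =>
    (auxP_contDiff_one c ha.continuous ((hf j).continuous_deriv le_rfl)).comp_contDiffOn hw1
  have c3 : ContDiffOn ℝ 2 (fun x => auxP a c B (w x)) U :=
    (auxP_contDiff_two c ha hB).comp_contDiffOn hw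
  have c4 : ∀ j, ContDiffOn ℝ 1 (pdX d (fun x => auxP a c B (w x)) j) U := fun j =>
    (c3.fderiv_of_isOpen hU (by norm_num)).clm_apply contDiffOn_const
  haveI : (volume : Measure ((Fin d → ℝ) × ℝ)).IsAddHaarMeasure :=
    Measure.prod.instIsAddHaarMeasure volume volume
  have i1 := aux_ibp (μ := volume) hU c1 hφ1 hc hs (0, 1)
  have i2 := fun j => aux_ibp (μ := volume) hU (c2 j) hφ1 hc hs (Pi.single j 1, 0)
  have hφX : ∀ j, ContDiff ℝ 1 (pdX d φ j) := fun j =>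
    (hφ2.fderiv_right (by norm_num)).clm_apply contDiff_const
  have i3 := fun j => aux_ibp (μ := volume) hU (c3.of_le (by norm_num)) (hφX j)
    (hc.fderiv_apply ℝ _) ((tsupport_fderiv_apply_subset ℝ _).trans hs) (Pi.single j 1, 0)
  have i4 := fun j => aux_ibp (μ := volume) hU (c4 j) hφ1 hc hs (Pi.single j 1, 0)
  have cont : ∀ {g : (Fin d → ℝ) × ℝ → ℝ} (_ : ContDiffOn ℝ 1 g U) (e : (Fin d → ℝ) × ℝ),
      Integrable (fun x => fderiv ℝ g x e * φ x) := fun hg e =>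
    aux_int_mul hU ((hg.continuousOn_fderiv_of_isOpen hU le_rfl).clm_apply continuousOn_const)
      hφ1.continuous hc hs
  have n1 := cont c1 (0, 1)
  have n2 := fun j => cont (c2 j) (Pi.single j 1, 0)
  have n4 := fun j => cont (c4 j) (Pi.single j 1, 0)
  have main : (∫ p, fderiv ℝ (fun x => auxP a c (deriv fun s => s) (w x)) p (0, 1) * φ p)
      + (∑ j, ∫ p, fderiv ℝ (fun x => auxP a c (deriv (f j)) (w x)) p (Pi.single j 1, 0) * φ p)
      ≤ ε * ∑ j, ∫ p, fderiv ℝ (pdX d (fun x => auxP a c B (w x)) j) p (Pi.single j 1, 0) * φ p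
      := by
    rw [← integral_finset_sum _ (fun j _ => n2 j), ← integral_finset_sum _ (fun j _ => n4 j),
      ← integral_add n1 (integrable_finset_sum _ (fun j _ => n2 j)), ← integral_const_mul]
    apply integral_mono (n1.add (integrable_finset_sum _ (fun j _ => n2 j)))
      ((integrable_finset_sum _ (fun j _ => n4 j)).const_mul ε)
    intro p
    by_cases hp : p ∈ U
    · have := aux_pointwise d hU hf hB hB0 ha ha' c hε hw hp (hpde p hp)
      have h := mul_le_mul_of_nonneg_right this (h0 p)
      rw [add_mul, mul_assoc, Finset.sum_mul, Finset.sum_mul] at h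
      exact h
    · have : φ p = 0 := image_eq_zero_of_notMem_tsupport fun h => hp (hs h)
      simp [this]
  have e1 : ∫ p, auxP a c (deriv fun s => s) (w p) * pdT d φ p
    = -∫ p, fderiv ℝ (fun x => auxP a c (deriv fun s => s) (w x)) p (0, 1) * φ p := i1
  have e2 : ∀ j, ∫ p, auxP a c (deriv (f j)) (w p) * pdX d φ j p
    = -∫ p, fderiv ℝ (fun x => auxP a c (deriv (f j)) (w x)) p (Pi.single j 1, 0) * φ p := i2
  have e3 : ∀ j, ∫ p, auxP a c B (w p) * pdXX d φ j p
    = ∫ p, fderiv ℝ (pdX d (fun x => auxP a c B (w x)) j) p (Pi.single j 1, 0) * φ p := by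
    intro j
    have h3 := i3 j
    have h4 := i4 j
    rw [← neg_eq_iff_eq_neg] at h4
    rw [← h4]
    exact h3
  rw [e1]
  simp only [e2, e3, Finset.sum_neg_distrib]
  linarith

/-- the a.e. limit of uniformly bounded quasilinear viscous approximations
with vanishing viscosity satisfies the interior Kruzhkov entropy inequalities. -/
theorem stmt13 (d : ℕ) (Ω : Set (Fin d → ℝ)) (hΩo : IsOpen Ω)
    (hΩb : Bornology.IsBounded Ω) (T : ℝ) (hT : 0 < T)
    (f : Fin d → ℝ → ℝ) (hf : FluxOK d f)
    (B : ℝ → ℝ) (r : ℝ) (hB : DiffusionOK B r)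
    (M : ℝ) (hM : 0 < M)
    (εs : ℕ → ℝ) (hεs : ∀ k, 0 < εs k) (hεlim : Tendsto εs atTop (nhds 0))
    (v : ℕ → (Fin d → ℝ) × ℝ → ℝ)
    (hsm : ∀ k, ContDiffOn ℝ 2 (v k) (closure (Ω ×ˢ Ioo (0:ℝ) T)))
    (hpde : ∀ k, ∀ x ∈ Ω, ∀ t ∈ Ioo (0:ℝ) T,
      pdT d (v k) (x, t) + ∑ j, deriv (f j) (v k (x, t)) * pdX d (v k) j (x, t)
        = εs k * (B (v k (x, t)) * lapX d (v k) (x, t)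
            + deriv B (v k (x, t)) * ∑ j, pdX d (v k) j (x, t) ^ 2))
    (hbdry : ∀ k, ∀ x ∈ frontier Ω, ∀ t ∈ Ioo (0:ℝ) T, v k (x, t) = 0)
    (hbd : ∀ k, ∀ p ∈ Ω ×ˢ Ioo (0:ℝ) T, |v k p| ≤ M)
    (hgrad : ∀ k, εs k * ∫ p in Ω ×ˢ Ioo (0:ℝ) T, ∑ j, (pdX d (v k) j p) ^ 2 ≤ M)
    (u : (Fin d → ℝ) × ℝ → ℝ) (hmeas : Measurable u)
    (hae : ∀ᵐ p ∂(volume.restrict (Ω ×ˢ Ioo (0:ℝ) T)),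
      Tendsto (fun k => v k p) atTop (nhds (u p))) :
    ∀ c : ℝ, ∀ φ : (Fin d → ℝ) × ℝ → ℝ, ContDiff ℝ (⊤ : ℕ∞) φ → HasCompactSupport φ →
      tsupport φ ⊆ Ω ×ˢ Ioo (0:ℝ) T → (∀ p, 0 ≤ φ p) →
      0 ≤ ∫ p in Ω ×ˢ Ioo (0:ℝ) T,
        (|u p - c| * pdT d φ p
          + Real.sign (u p - c) * ∑ j, (f j (u p) - f j c) * pdX d φ j p) := by
  intro c φ hφ hcs hsupp hφ0
  obtain ⟨hf1, L, hL⟩ := hf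
  obtain ⟨hB3, ⟨K, hK⟩, hr, hBr⟩ := hB
  have hB1 : ContDiff ℝ 1 B := hB3.of_le (by norm_num)
  set U : Set ((Fin d → ℝ) × ℝ) := Ω ×ˢ Ioo (0:ℝ) T with hUdef
  have hU : IsOpen U := hΩo.prod isOpen_Ioo
  have hUm : MeasurableSet U := hU.measurableSet
  haveI : (volume : Measure ((Fin d → ℝ) × ℝ)).IsAddHaarMeasure :=
    Measure.prod.instIsAddHaarMeasure volume volume
  have hφ1 : ContDiff ℝ 1 φ := contDiff_infty.1 hφ 1
  have hφ2 : ContDiff ℝ 2 φ := contDiff_infty.1 hφ 2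
  have hφX : ∀ j, ContDiff ℝ 1 (pdX d φ j) := fun j =>
    (hφ2.fderiv_right (by norm_num)).clm_apply contDiff_const
  have cX : ∀ j, HasCompactSupport (pdX d φ j) := fun j => hcs.fderiv_apply ℝ _
  have sX : ∀ j, tsupport (pdX d φ j) ⊆ U := fun j =>
    (tsupport_fderiv_apply_subset ℝ _).trans hsupp
  have cT : HasCompactSupport (pdT d φ) := hcs.fderiv_apply ℝ _
  have sT : tsupport (pdT d φ) ⊆ U := (tsupport_fderiv_apply_subset ℝ _).trans hsupp
  have cXX : ∀ j, HasCompactSupport (pdXX d φ j) := fun j => (cX j).fderiv_apply ℝ _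
  have sXX : ∀ j, tsupport (pdXX d φ j) ⊆ U := fun j =>
    (tsupport_fderiv_apply_subset ℝ _).trans (sX j)
  have iT : Integrable (pdT d φ) (volume.restrict U) := by
    have : Continuous (pdT d φ) :=
      (hφ1.continuous_fderiv one_ne_zero).clm_apply continuous_const
    exact (this.integrable_of_hasCompactSupport cT).restrict
  have iX : ∀ j, Integrable (pdX d φ j) (volume.restrict U) := fun j =>
    ((hφX j).continuous.integrable_of_hasCompactSupport (cX j)).restrict
  have iXX : ∀ j, Integrable (pdXX d φ j) (volume.restrict U) := fun j => by
    have : Continuous (pdXX d φ j) :=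
      ((hφX j).continuous_fderiv one_ne_zero).clm_apply continuous_const
    exact (this.integrable_of_hasCompactSupport (cXX j)).restrict
  -- from whole space integrals to integrals over `U`
  have toU : ∀ (g ψ : (Fin d → ℝ) × ℝ → ℝ), tsupport ψ ⊆ U →
      ∫ p, g p * ψ p = ∫ p in U, g p * ψ p := by
    intro g ψ hψ
    symm
    apply setIntegral_eq_integral_of_forall_compl_eq_zero
    intro p hp
    rw [image_eq_zero_of_notMem_tsupport fun h => hp (hψ h), mul_zero]
  have hw : ∀ k, ContDiffOn ℝ 2 (v k) U := fun k => (hsm k).mono subset_closure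
  -- viscous inequalities
  have visc : ∀ n k, 0 ≤ (∫ p in U, auxP (auxA c n) c (deriv fun s => s) (v k p) * pdT d φ p)
      + (∑ j, ∫ p in U, auxP (auxA c n) c (deriv (f j)) (v k p) * pdX d φ j p)
      + εs k * ∑ j, ∫ p in U, auxP (auxA c n) c B (v k p) * pdXX d φ j p := by
    intro n k
    have := aux_visc d hU hf1 hB1 (fun s => hr.le.trans (hBr s)) (auxA_contDiff c n)
      (auxA_deriv_nonneg c n) c (hεs k) (hw k)
      (fun p hp => hpde k p.1 hp.1 p.2 hp.2) hφ hcs hsupp hφ0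
    rw [toU _ _ sT] at this
    simp only [toU _ _ (sX _), toU _ _ (sXX _)] at this
    exact this
  have hidb : ∀ s : ℝ, |deriv (fun s : ℝ => s) s| ≤ 1 := fun s => by simp
  have hidc : Continuous (deriv fun s : ℝ => s) := by
    rw [show (deriv fun s : ℝ => s) = fun _ => 1 by funext s; simp]; exact continuous_const
  -- bound on the limit
  have hub : ∀ᵐ p ∂(volume.restrict U), |u p| ≤ M := by
    filter_upwards [hae, ae_restrict_mem hUm] with p hp hpU
    exact le_of_tendsto hp.abs (Eventually.of_forall fun k => hbd k p hpU)
  have bnd : ∀ {g : ℝ → ℝ} {C : ℝ} (_ : ∀ s, |g s| ≤ C) (n : ℕ) (s : ℝ), |s| ≤ M →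
      |auxP (auxA c n) c g s| ≤ C * (M + |c|) := by
    intro g C hg n s hsM
    have hC : 0 ≤ C := (abs_nonneg _).trans (hg 0)
    refine (auxP_bound c (auxA_abs c n) hg s).trans ?_
    gcongr
    exact (abs_sub s c).trans (by linarith)
  -- first limit
  have lim1 : ∀ (n : ℕ) {g : ℝ → ℝ} {C : ℝ} (_ : Continuous g) (_ : ∀ s, |g s| ≤ C)
      {ψ : (Fin d → ℝ) × ℝ → ℝ} (_ : Integrable ψ (volume.restrict U)),
      Tendsto (fun k => ∫ p in U, auxP (auxA c n) c g (v k p) * ψ p) atTop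
        (𝓝 (∫ p in U, auxP (auxA c n) c g (u p) * ψ p)) := by
    intro n g C hgc hg ψ hψ
    have hPc : Continuous (auxP (auxA c n) c g) :=
      (auxP_contDiff_one c (auxA_contDiff c n).continuous hgc).continuous
    apply aux_dct (C * (M + |c|))
    · intro k
      exact (hPc.comp_continuousOn (hw k).continuousOn).aestronglyMeasurable hUm
    · intro k
      filter_upwards [ae_restrict_mem hUm] with p hp
      exact bnd hg n _ (hbd k p hp)
    · exact hψ
    · filter_upwards [hae] with p hp
      exact (hPc.tendsto _).comp hp
  have ineq1 : ∀ n, 0 ≤ (∫ p in U, auxP (auxA c n) c (deriv fun s => s) (u p) * pdT d φ p)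
      + (∑ j, ∫ p in U, auxP (auxA c n) c (deriv (f j)) (u p) * pdX d φ j p) := by
    intro n
    have l1 := lim1 n hidc hidb iT
    have l2 := tendsto_finsetSum Finset.univ (fun j _ =>
      lim1 n ((hf1 j).continuous_deriv le_rfl) (hL j) (iX j))
    have l3 := tendsto_finsetSum Finset.univ (fun j _ =>
      lim1 n hB1.continuous hK (iXX j))
    have l := (l1.add l2).add (hεlim.mul l3)
    rw [zero_mul, add_zero] at l
    exact ge_of_tendsto l (Eventually.of_forall fun k => visc n k)
  -- second limit
  have lim2 : ∀ {F : ℝ → ℝ} {C : ℝ} (_ : ContDiff ℝ 1 F) (_ : ∀ s, |deriv F s| ≤ C)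
      {ψ : (Fin d → ℝ) × ℝ → ℝ} (_ : Integrable ψ (volume.restrict U)),
      Tendsto (fun n => ∫ p in U, auxP (auxA c n) c (deriv F) (u p) * ψ p) atTop
        (𝓝 (∫ p in U, (Real.sign (u p - c) * (F (u p) - F c)) * ψ p)) := by
    intro F C hF hC ψ hψ
    apply aux_dct (C * (M + |c|))
    · intro n
      have hPc : Continuous (auxP (auxA c n) c (deriv F)) :=
        (auxP_contDiff_one c (auxA_contDiff c n).continuous
          (hF.continuous_deriv le_rfl)).continuous
      exact (hPc.measurable.comp hmeas).aestronglyMeasurable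
    · intro n
      filter_upwards [hub] with p hp
      exact bnd hC n _ hp
    · exact hψ
    · exact Eventually.of_forall fun p => auxP_tendsto c hF hC (u p)
  have intg : ∀ {F : ℝ → ℝ} {C : ℝ} (_ : ContDiff ℝ 1 F) (_ : ∀ s, |deriv F s| ≤ C)
      {ψ : (Fin d → ℝ) × ℝ → ℝ} (_ : Integrable ψ (volume.restrict U)),
      Integrable (fun p => (Real.sign (u p - c) * (F (u p) - F c)) * ψ p)
        (volume.restrict U) := by
    intro F C hF hC ψ hψ
    refine Integrable.bdd_mul (c := C * (M + |c|)) hψ ?_ ?_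
    · have hm : ∀ n, Measurable fun p => auxP (auxA c n) c (deriv F) (u p) := fun n =>
        (auxP_contDiff_one c (auxA_contDiff c n).continuous
          (hF.continuous_deriv le_rfl)).continuous.measurable.comp hmeas
      exact (measurable_of_tendsto_metrizable hm (tendsto_pi_nhds.2 fun p =>
        auxP_tendsto c hF hC (u p))).aestronglyMeasurable
    · filter_upwards [hub] with p hp
      exact le_of_tendsto (auxP_tendsto c hF hC (u p)).abs
        (Eventually.of_forall fun n => bnd hC n _ hp)
  have hid1 : ContDiff ℝ 1 (fun s : ℝ => s) := contDiff_id
  have fin : 0 ≤ (∫ p in U, (Real.sign (u p - c) * (u p - c)) * pdT d φ p)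
      + ∑ j, ∫ p in U, (Real.sign (u p - c) * (f j (u p) - f j c)) * pdX d φ j p := by
    have l1 := lim2 hid1 hidb iT
    have l2 := tendsto_finsetSum Finset.univ (fun j _ => lim2 (hf1 j) (hL j) (iX j))
    exact ge_of_tendsto (l1.add l2) (Eventually.of_forall ineq1)
  rw [← integral_finset_sum _ (fun j _ => intg (hf1 j) (hL j) (iX j)),
    ← integral_add (intg hid1 hidb iT)
      (integrable_finset_sum _ (fun j _ => intg (hf1 j) (hL j) (iX j)))] at fin
  refine fin.trans_eq (integral_congr_ae (Eventually.of_forall fun p => ?_))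
  have hsg : Real.sign (u p - c) * (u p - c) = |u p - c| := by
    rcases lt_trichotomy (u p - c) 0 with h | h | h
    · rw [Real.sign_of_neg h, abs_of_neg h]; ring
    · simp [h]
    · rw [Real.sign_of_pos h, abs_of_pos h]; ring
  simp only [hsg, Finset.mul_sum, mul_assoc]

end
end

section
/- Let Ω be a bounded open subset of ℝ^d, T > 0 and Ω_T = Ω × (0,T). Let f : ℝ → ℝ^d be C¹ with bounded derivative, let B : ℝ → ℝ be C³ and bounded with B(s) ≥ r > 0 for all s ∈ ℝ. Let u₀ ∈ BV(Ω) ∩ L^∞(Ω) have essential support a compact subset of Ω, extend u₀ by zero to ℝ^d, and set u_{0ε} = u₀ ⋆ ρ_ε where (ρ_ε) is a standard mollifier on ℝ^d. Let (ε_k) be a sequence of positive reals with ε_k → 0, for each k let u^{ε_k} ∈ C²(closure(Ω_T)) be a classical solution of ∂_t u^{ε_k} + ∇·(f(u^{ε_k})) = ε_k ∇·(B(u^{ε_k}) ∇u^{ε_k}) in Ω_T with u^{ε_k} = 0 on ∂Ω × (0,T) and u^{ε_k}(·,0) = u_{0ε_k}, and suppose u^{ε_k} → u in L¹(Ω_T)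 and almost everywhere in Ω_T for some u ∈ L¹(Ω_T). Then u attains the initial data u₀ in the L¹ sense: ess lim_{t → 0+} ∫_Ω |u(x,t) − u₀(x)| dx = 0. -/
open MeasureTheory Set Filter Topology

noncomputable section

lemma aux_ibp0 {d : ℕ} {Ω : Set (Fin d → ℝ)} (hΩ : IsOpen Ω) {C : Set (Fin d → ℝ)}
    (hC : IsCompact C) (hCΩ : C ⊆ Ω) {H : (Fin d → ℝ) → ℝ}
    (hH : ∀ x ∈ Ω, ContDiffAt ℝ 1 H x) (h0 : ∀ x ∈ Ω, x ∉ C → H x = 0) (e : Fin d → ℝ) :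
    IntegrableOn (fun x => fderiv ℝ H x e) Ω ∧ ∫ x in Ω, fderiv ℝ H x e = 0 := by
  set G : (Fin d → ℝ) → ℝ := indicator Ω H with hG
  have hGin : ∀ x ∈ Ω, G =ᶠ[𝓝 x] H := by
    intro x hx
    filter_upwards [hΩ.mem_nhds hx] with y hy
    simp [hG, hy]
  have hG0 : ∀ x, x ∉ C → G x = 0 := by
    intro x hx
    by_cases hxo : x ∈ Ω
    · simp [hG, hxo, h0 x hxo hx]
    · simp [hG, hxo]
  have hGout : ∀ x, x ∉ C → G =ᶠ[𝓝 x] fun _ => 0 := by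
    intro x hx
    filter_upwards [hC.isClosed.isOpen_compl.mem_nhds hx] with y hy
    exact hG0 y hy
  have hGc : ContDiff ℝ 1 G := by
    rw [contDiff_iff_contDiffAt]
    intro x
    by_cases hx : x ∈ C
    · exact (hH x (hCΩ hx)).congr_of_eventuallyEq (hGin x (hCΩ hx))
    · exact contDiffAt_const.congr_of_eventuallyEq (hGout x hx)
  have hGs : HasCompactSupport G := HasCompactSupport.intro hC hG0
  have hGd : HasCompactSupport (fun x => fderiv ℝ G x e) := by
    refine HasCompactSupport.intro hC ?_
    intro x hx
    rw [(hGout x hx).fderiv_eq]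
    simp
  have hcont : Continuous (fun x => fderiv ℝ G x e) :=
    (hGc.continuous_fderiv (by norm_num)).clm_apply continuous_const
  have hint : Integrable (fun x => fderiv ℝ G x e) := hcont.integrable_of_hasCompactSupport hGd
  have hGint : Integrable G := hGc.continuous.integrable_of_hasCompactSupport hGs
  have key : ∫ x, fderiv ℝ G x e = 0 := by
    have := integral_mul_fderiv_eq_neg_fderiv_mul_of_integrable (μ := volume)
      (f := fun _ : Fin d → ℝ => (1:ℝ)) (g := G) (v := e) (by simp) (by simpa using hint)
      (by simpa using hGint) (fun x _ => by fun_prop)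
      (fun x _ => hGc.contDiffAt.differentiableAt (by norm_num))
    simpa using this
  have heq : ∀ x ∈ Ω, fderiv ℝ H x e = fderiv ℝ G x e := fun x hx => by
    rw [(hGin x hx).fderiv_eq]
  refine ⟨(integrableOn_congr_fun heq hΩ.measurableSet).2 hint.integrableOn, ?_⟩
  rw [setIntegral_congr_fun hΩ.measurableSet heq, setIntegral_eq_integral_of_forall_compl_eq_zero, key]
  intro x hx
  rw [(hGout x (fun h => hx (hCΩ h))).fderiv_eq]
  simp

lemma aux_pd_contDiffAt {d : ℕ} {w : (Fin d → ℝ) → ℝ} {x : Fin d → ℝ}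
    (hw : ContDiffAt ℝ 2 w x) (j : Fin d) : ContDiffAt ℝ 1 (pd d w j) x := by
  have : ContDiffAt ℝ 1 (fderiv ℝ w) x := hw.fderiv_right (by norm_num)
  exact this.clm_apply contDiffAt_const

lemma aux_prim (g : ℝ → ℝ) (hg : Continuous g) :
    ∃ Q : ℝ → ℝ, Q 0 = 0 ∧ (∀ s, HasDerivAt Q (g s) s) ∧ ContDiff ℝ 1 Q := by
  have h : ∀ s, HasDerivAt (fun s => ∫ y in (0:ℝ)..s, g y) (g s) s := fun s =>
    intervalIntegral.integral_hasDerivAt_right (hg.intervalIntegrable _ _)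
      (hg.stronglyMeasurableAtFilter _ _) hg.continuousAt
  refine ⟨_, by simp, h, ?_⟩
  rw [contDiff_one_iff_deriv]
  refine ⟨fun s => (h s).differentiableAt, ?_⟩
  rwa [show deriv (fun s => ∫ y in (0:ℝ)..s, g y) = g from funext fun s => (h s).deriv]

lemma aux_energy_ibp {d : ℕ} {Ω : Set (Fin d → ℝ)} (hΩ : IsOpen Ω) {C : Set (Fin d → ℝ)}
    (hC : IsCompact C) (hCΩ : C ⊆ Ω) {w : (Fin d → ℝ) → ℝ}
    (hw : ∀ x ∈ Ω, ContDiffAt ℝ 2 w x) {κ : ℝ}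
    (hκ : ∀ x ∈ Ω, x ∉ C → |w x| < κ)
    {f : Fin d → ℝ → ℝ} (hf : ∀ j, ContDiff ℝ 1 (f j))
    {B : ℝ → ℝ} (hB : ContDiff ℝ 1 B) (hB0 : ∀ s, 0 ≤ B s) {ε : ℝ} (hε : 0 ≤ ε)
    {s1 : ℝ → ℝ} (hs1 : ContDiff ℝ 1 s1) (hs10 : ∀ s, |s| < κ → s1 s = 0)
    (hs1' : ∀ s, 0 ≤ deriv s1 s) :
    ∫ x in Ω, s1 (w x) * (ε * (B (w x) * lap d w x + deriv B (w x) * ∑ j, pd d w j x ^ 2)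
      - ∑ j, deriv (f j) (w x) * pd d w j x) ≤ 0 := by
  have hQ := fun j => aux_prim (fun s => s1 s * deriv (f j) s)
    (hs1.continuous.mul ((hf j).continuous_deriv (by norm_num)))
  choose Q hQ0 hQd hQc using hQ
  have hQz : ∀ j s, |s| < κ → Q j s = 0 := by
    intro j s hs
    have hcv : Convex ℝ (Ioo (-κ) κ) := convex_Ioo _ _
    have := hcv.is_const_of_fderivWithin_eq_zero (𝕜 := ℝ) (f := Q j)
      (fun y _ => (hQd j y).differentiableAt.differentiableWithinAt) ?_ (x := s) (y := 0)
      (by rw [abs_lt] at hs; exact hs) (by have := (abs_nonneg s).trans_lt hs; constructor <;> linarith)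
    · rw [this, hQ0]
    · intro y hy
      rw [fderivWithin_of_isOpen isOpen_Ioo hy]
      ext
      simp [(hQd j y).deriv, hs10 y (abs_lt.2 hy)]
  set H : Fin d → (Fin d → ℝ) → ℝ := fun j x =>
    -Q j (w x) + ε * (s1 (w x) * B (w x) * pd d w j x) with hH
  have h1 := fun j => aux_ibp0 hΩ hC hCΩ (H := H j) (by
      intro x hx
      have hwx : ContDiffAt ℝ 1 w x := (hw x hx).of_le (by norm_num)
      have a1 := (hQc j).contDiffAt.comp x hwx
      have a2 := hs1.contDiffAt.comp x hwx
      have a3 := hB.contDiffAt.comp x hwx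
      have a4 := aux_pd_contDiffAt (hw x hx) j
      exact a1.neg.add (contDiffAt_const.mul ((a2.mul a3).mul a4))) (by
      intro x hx hxC
      simp [hH, hQz j _ (hκ x hx hxC), hs10 _ (hκ x hx hxC)]) (Pi.single j 1)
  have h2 : ∀ x ∈ Ω, s1 (w x) * (ε * (B (w x) * lap d w x + deriv B (w x) * ∑ j, pd d w j x ^ 2)
      - ∑ j, deriv (f j) (w x) * pd d w j x)
      = (∑ j, fderiv ℝ (H j) x (Pi.single j 1))
        - ε * deriv s1 (w x) * B (w x) * ∑ j, pd d w j x ^ 2 := by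
    intro x hx
    have hwd : HasFDerivAt w (fderiv ℝ w x) x :=
      ((hw x hx).differentiableAt (by norm_num)).hasFDerivAt
    have hd : ∀ j, fderiv ℝ (H j) x (Pi.single j 1) =
        -(s1 (w x) * deriv (f j) (w x) * pd d w j x) +
        ε * (deriv s1 (w x) * pd d w j x * B (w x) * pd d w j x +
          s1 (w x) * (deriv B (w x) * pd d w j x) * pd d w j x +
          s1 (w x) * B (w x) * pd d (pd d w j) j x) := by
      intro j
      have a1 := (hQd j (w x)).comp_hasFDerivAt x hwd
      have a2 := ((hs1.differentiable (by norm_num)) (w x)).hasDerivAt.comp_hasFDerivAt x hwd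
      have a3 := ((hB.differentiable (by norm_num)) (w x)).hasDerivAt.comp_hasFDerivAt x hwd
      have a4 : HasFDerivAt (pd d w j) _ x :=
        ((aux_pd_contDiffAt (hw x hx) j).differentiableAt (by norm_num)).hasFDerivAt
      have a5 := a1.neg.add (((a2.mul a3).mul a4).const_mul ε)
      have a6 : fderiv ℝ (H j) x = _ := HasFDerivAt.fderiv a5
      rw [a6]
      simp [pd]
      ring
    simp only [hd, lap]
    simp only [Finset.mul_sum, mul_sub, mul_add, ← Finset.sum_sub_distrib, ← Finset.sum_add_distrib]
    apply Finset.sum_congr rfl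
    intro j _
    ring
  rw [setIntegral_congr_fun hΩ.measurableSet h2]
  by_cases hI : IntegrableOn (fun x => (∑ j, fderiv ℝ (H j) x (Pi.single j 1))
        - ε * deriv s1 (w x) * B (w x) * ∑ j, pd d w j x ^ 2) Ω
  · have hS : IntegrableOn (fun x => ∑ j, fderiv ℝ (H j) x (Pi.single j 1)) Ω :=
      integrable_finsetSum _ fun j _ => (h1 j).1
    have h3 : ∫ x in Ω, ∑ j, fderiv ℝ (H j) x (Pi.single j 1) = 0 := by
      rw [integral_finsetSum _ fun j _ => (h1 j).1]
      exact Finset.sum_eq_zero fun j _ => (h1 j).2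
    rw [← h3]
    refine integral_mono hI hS fun x => ?_
    have : 0 ≤ ε * deriv s1 (w x) * B (w x) * ∑ j, pd d w j x ^ 2 := by
      have := hs1' (w x); have := hB0 (w x)
      have : 0 ≤ ∑ j, pd d w j x ^ 2 := Finset.sum_nonneg fun j _ => sq_nonneg _
      positivity
    simp only
    linarith
  · exact (integral_undef hI).le

lemma aux_weak_ibp {d : ℕ} {Ω : Set (Fin d → ℝ)} (hΩ : IsOpen Ω) {w φ : (Fin d → ℝ) → ℝ}
    (hw : ∀ x ∈ Ω, ContDiffAt ℝ 2 w x)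
    (hφ : ContDiff ℝ 2 φ) (hφc : HasCompactSupport φ) (hφΩ : tsupport φ ⊆ Ω)
    {f : Fin d → ℝ → ℝ} (hf : ∀ j, ContDiff ℝ 1 (f j))
    {B : ℝ → ℝ} (hB : ContDiff ℝ 1 B) {ε : ℝ} {P : ℝ → ℝ} (hP : ContDiff ℝ 1 P)
    (hPd : ∀ s, HasDerivAt P (B s) s)
    (hI : IntegrableOn (fun x => (∑ j, f j (w x) * pd d φ j x) + ε * (P (w x) * lap d φ x)) Ω) :
    ∫ x in Ω, φ x * (ε * (B (w x) * lap d w x + deriv B (w x) * ∑ j, pd d w j x ^ 2)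
      - ∑ j, deriv (f j) (w x) * pd d w j x) =
    ∫ x in Ω, ((∑ j, f j (w x) * pd d φ j x) + ε * (P (w x) * lap d φ x)) := by
  have hpd0 : ∀ j x, x ∉ tsupport φ → pd d φ j x = 0 := by
    intro j x hx
    have : fderiv ℝ φ x = 0 := by
      by_contra h
      exact hx (support_fderiv_subset ℝ h)
    simp [pd, this]
  set H : Fin d → (Fin d → ℝ) → ℝ := fun j x =>
    ε * (φ x * (B (w x) * pd d w j x)) - φ x * f j (w x) - ε * (P (w x) * pd d φ j x) with hH
  have h1 := fun j => aux_ibp0 hΩ hφc hφΩ (H := H j) (by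
      intro x hx
      have hwx : ContDiffAt ℝ 1 w x := (hw x hx).of_le (by norm_num)
      have a1 := (hf j).contDiffAt.comp x hwx
      have a2 := hP.contDiffAt.comp x hwx
      have a3 := hB.contDiffAt.comp x hwx
      have a4 := aux_pd_contDiffAt (hw x hx) j
      have a5 := aux_pd_contDiffAt (hφ.contDiffAt (x := x)) j
      have a6 : ContDiffAt ℝ 1 φ x := hφ.contDiffAt.of_le (by norm_num)
      exact ((contDiffAt_const.mul (a6.mul (a3.mul a4))).sub (a6.mul a1)).sub
        (contDiffAt_const.mul (a2.mul a5))) (by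
      intro x hx hxC
      simp [hH, hpd0 j x hxC, image_eq_zero_of_notMem_tsupport hxC]) (Pi.single j 1)
  have h2 : ∀ x ∈ Ω, φ x * (ε * (B (w x) * lap d w x + deriv B (w x) * ∑ j, pd d w j x ^ 2)
      - ∑ j, deriv (f j) (w x) * pd d w j x)
      = (∑ j, fderiv ℝ (H j) x (Pi.single j 1))
        + ((∑ j, f j (w x) * pd d φ j x) + ε * (P (w x) * lap d φ x)) := by
    intro x hx
    have hwd : HasFDerivAt w (fderiv ℝ w x) x :=
      ((hw x hx).differentiableAt (by norm_num)).hasFDerivAt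
    have hφd : HasFDerivAt φ (fderiv ℝ φ x) x :=
      (hφ.contDiffAt.differentiableAt (by norm_num)).hasFDerivAt
    have hd : ∀ j, fderiv ℝ (H j) x (Pi.single j 1) =
        ε * (pd d φ j x * (B (w x) * pd d w j x) + φ x * (deriv B (w x) * pd d w j x * pd d w j x
          + B (w x) * pd d (pd d w j) j x))
        - (pd d φ j x * f j (w x) + φ x * (deriv (f j) (w x) * pd d w j x))
        - ε * (B (w x) * pd d w j x * pd d φ j x + P (w x) * pd d (pd d φ j) j x) := by
      intro j
      have a1 := (((hf j).differentiable (by norm_num)) (w x)).hasDerivAt.comp_hasFDerivAt x hwd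
      have a2 := (hPd (w x)).comp_hasFDerivAt x hwd
      have a3 := ((hB.differentiable (by norm_num)) (w x)).hasDerivAt.comp_hasFDerivAt x hwd
      have a4 : HasFDerivAt (pd d w j) _ x :=
        ((aux_pd_contDiffAt (hw x hx) j).differentiableAt (by norm_num)).hasFDerivAt
      have a5 : HasFDerivAt (pd d φ j) _ x :=
        ((aux_pd_contDiffAt (hφ.contDiffAt (x := x)) j).differentiableAt (by norm_num)).hasFDerivAt
      have a7 := (((hφd.mul (a3.mul a4)).const_mul ε).sub (hφd.mul a1)).sub
        ((a2.mul a5).const_mul ε)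
      have a6 : fderiv ℝ (H j) x = _ := HasFDerivAt.fderiv a7
      rw [a6]
      simp [pd]
      ring
    simp only [hd, lap]
    simp only [Finset.mul_sum, mul_sub, mul_add, ← Finset.sum_sub_distrib, ← Finset.sum_add_distrib]
    apply Finset.sum_congr rfl
    intro j _
    ring
  rw [setIntegral_congr_fun hΩ.measurableSet h2]
  have hS : IntegrableOn (fun x => ∑ j, fderiv ℝ (H j) x (Pi.single j 1)) Ω :=
      integrable_finsetSum _ fun j _ => (h1 j).1
  have h3 : ∫ x in Ω, ∑ j, fderiv ℝ (H j) x (Pi.single j 1) = 0 := by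
    rw [integral_finsetSum _ fun j _ => (h1 j).1]
    exact Finset.sum_eq_zero fun j _ => (h1 j).2
  rw [integral_add hS hI, h3, zero_add]


lemma aux_slice_fderiv {d : ℕ} {g : (Fin d → ℝ) × ℝ → ℝ} {x : Fin d → ℝ} {t : ℝ}
    (hg : DifferentiableAt ℝ g (x, t)) (e : Fin d → ℝ) :
    fderiv ℝ (fun y => g (y, t)) x e = fderiv ℝ g (x, t) (e, 0) := by
  have h1 : HasFDerivAt (fun y : Fin d → ℝ => (y, t)) _ x :=
    (hasFDerivAt_id (𝕜 := ℝ) x).prodMk (hasFDerivAt_const t x)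
  have h2 := HasFDerivAt.comp (g := g) x hg.hasFDerivAt h1
  have h3 : fderiv ℝ (fun y => g (y, t)) x = _ := h2.fderiv
  rw [h3]
  simp

lemma aux_slice_time {d : ℕ} {g : (Fin d → ℝ) × ℝ → ℝ} {x : Fin d → ℝ} {t : ℝ}
    (hg : DifferentiableAt ℝ g (x, t)) :
    HasDerivAt (fun s => g (x, s)) (pdT d g (x, t)) t := by
  have h1 : HasDerivAt (fun s : ℝ => (x, s)) ((0 : Fin d → ℝ), (1:ℝ)) t :=
    (hasDerivAt_const t x).prodMk (hasDerivAt_id t)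
  exact HasFDerivAt.comp_hasDerivAt t hg.hasFDerivAt h1

lemma aux_slice_cont {d : ℕ} {Ω : Set (Fin d → ℝ)} {T : ℝ} {P : (Fin d → ℝ) × ℝ → ℝ}
    (hPc : ContinuousOn P (closure Ω ×ˢ Icc 0 T)) {t : ℝ} (ht : t ∈ Icc 0 T) :
    ContinuousOn (fun x => P (x, t)) (closure Ω) :=
  hPc.comp (by fun_prop) fun _ hx => ⟨hx, ht⟩

lemma aux_bdd {d : ℕ} {Ω : Set (Fin d → ℝ)} (hb : Bornology.IsBounded Ω) {T : ℝ}
    {P : (Fin d → ℝ) × ℝ → ℝ}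
    (hPc : ContinuousOn P (closure Ω ×ˢ Icc 0 T)) :
    ∃ M, ∀ x ∈ closure Ω, ∀ t ∈ Icc 0 T, |P (x, t)| ≤ M := by
  obtain ⟨M, hM⟩ := (hb.isCompact_closure.prod isCompact_Icc).exists_bound_of_continuousOn hPc
  exact ⟨M, fun x hx t ht => hM (x, t) ⟨hx, ht⟩⟩

lemma aux_fin {d : ℕ} {Ω : Set (Fin d → ℝ)} (hb : Bornology.IsBounded Ω) :
    IsFiniteMeasure (volume.restrict Ω) :=
  ⟨by simpa using hb.measure_lt_top⟩

lemma aux_E_cont {d : ℕ} {Ω : Set (Fin d → ℝ)} (hΩ : IsOpen Ω) (hb : Bornology.IsBounded Ω)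
    {T : ℝ} {P : (Fin d → ℝ) × ℝ → ℝ} (hPc : ContinuousOn P (closure Ω ×ˢ Icc 0 T)) :
    ContinuousOn (fun t => ∫ x in Ω, P (x, t)) (Icc 0 T) := by
  have := aux_fin hb
  obtain ⟨M, hM⟩ := aux_bdd hb hPc
  refine continuousOn_of_dominated (bound := fun _ => M) ?_ ?_ (integrable_const M) ?_
  · intro t ht
    exact ((aux_slice_cont hPc ht).mono subset_closure).aestronglyMeasurable hΩ.measurableSet
  · intro t ht
    filter_upwards [ae_restrict_mem hΩ.measurableSet] with x hx
    exact hM x (subset_closure hx) t ht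
  · filter_upwards [ae_restrict_mem hΩ.measurableSet] with x hx
    exact hPc.comp (by fun_prop) fun t ht => ⟨subset_closure hx, ht⟩

lemma aux_E_deriv {d : ℕ} {Ω : Set (Fin d → ℝ)} (hΩ : IsOpen Ω) (hb : Bornology.IsBounded Ω)
    {T : ℝ} {P : (Fin d → ℝ) × ℝ → ℝ} (hPc : ContinuousOn P (closure Ω ×ˢ Icc 0 T))
    (hP1 : ∀ x ∈ Ω, ∀ t ∈ Ioo 0 T, ContDiffAt ℝ 1 P (x, t))
    {C : Set ((Fin d → ℝ) × ℝ)} (hC : IsClosed C)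
    (hCf : ∀ x ∈ frontier Ω, ∀ t ∈ Ioo 0 T, (x, t) ∉ C)
    (h0 : ∀ x ∈ Ω, ∀ t ∈ Ioo 0 T, (x, t) ∉ C → pdT d P (x, t) = 0)
    {t : ℝ} (ht : t ∈ Ioo 0 T) :
    HasDerivAt (fun t => ∫ x in Ω, P (x, t)) (∫ x in Ω, pdT d P (x, t)) t := by
  have := aux_fin hb
  obtain ⟨δ, hδ, hδs⟩ : ∃ δ > 0, Icc (t - δ) (t + δ) ⊆ Ioo 0 T := by
    refine ⟨min t (T - t) / 2, by have := ht.1; have := ht.2; have : 0 < min t (T - t) := lt_min ht.1 (by linarith)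
                                  positivity, ?_⟩
    intro s hs
    have h1 := min_le_left t (T - t)
    have h2 := min_le_right t (T - t)
    have h3 : 0 < min t (T - t) := lt_min ht.1 (by linarith [ht.2])
    constructor <;> linarith [hs.1, hs.2]
  have hpc : ContinuousOn (pdT d P) (Ω ×ˢ Ioo 0 T) := by
    intro p hp
    have h1 : ContDiffAt ℝ 1 P p := hP1 p.1 hp.1 p.2 hp.2
    have : ContDiffAt ℝ 0 (fderiv ℝ P) p := h1.fderiv_right (by norm_num)
    exact (this.continuousAt.clm_apply continuousAt_const).continuousWithinAt
  have hKc : IsCompact (C ∩ (closure Ω ×ˢ Icc (t - δ) (t + δ))) :=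
    (hb.isCompact_closure.prod isCompact_Icc).inter_left hC
  have hKs : C ∩ (closure Ω ×ˢ Icc (t - δ) (t + δ)) ⊆ Ω ×ˢ Ioo 0 T := by
    rintro ⟨x, s⟩ ⟨h1, h2, h3⟩
    refine ⟨?_, hδs h3⟩
    by_contra hx
    exact hCf x (by rw [frontier, hΩ.interior_eq]; exact ⟨h2, hx⟩) s (hδs h3) h1
  obtain ⟨M, hM⟩ := hKc.exists_bound_of_continuousOn (hpc.mono hKs)
  have hIoo : Ioo 0 T ⊆ Icc 0 T := Ioo_subset_Icc_self
  have hslice : ∀ s ∈ Ioo 0 T, AEStronglyMeasurable (fun x => P (x, s)) (volume.restrict Ω) :=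
    fun s hs => ((aux_slice_cont hPc (hIoo hs)).mono subset_closure).aestronglyMeasurable hΩ.measurableSet
  refine (hasDerivAt_integral_of_dominated_loc_of_deriv_le (bound := fun _ => max M 0)
    (F := fun s x => P (x, s)) (F' := fun s x => pdT d P (x, s))
    (Icc_mem_nhds (show t - δ < t by linarith) (show t < t + δ by linarith)) ?_ ?_ ?_ ?_
      (integrable_const _) ?_).2
  · filter_upwards [isOpen_Ioo.mem_nhds ht] with s hs
    exact hslice s hs
  · obtain ⟨M', hM'⟩ := aux_bdd hb hPc
    refine (integrable_const M').mono' (hslice t ht) ?_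
    filter_upwards [ae_restrict_mem hΩ.measurableSet] with x hx
    exact hM' x (subset_closure hx) t (hIoo ht)
  · have : ContinuousOn (fun x => pdT d P (x, t)) Ω :=
      hpc.comp (by fun_prop) fun x hx => ⟨hx, ht⟩
    exact this.aestronglyMeasurable hΩ.measurableSet
  · filter_upwards [ae_restrict_mem hΩ.measurableSet] with x hx s hs
    by_cases hxs : (x, s) ∈ C
    · exact (hM (x, s) ⟨hxs, subset_closure hx, hs⟩).trans (le_max_left _ _)
    · rw [h0 x hx s (hδs hs) hxs]
      simp
  · filter_upwards [ae_restrict_mem hΩ.measurableSet] with x hx s hs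
    exact aux_slice_time ((hP1 x hx s (hδs hs)).differentiableAt (by norm_num))

section sol
variable {d : ℕ} {Ω : Set (Fin d → ℝ)} {T : ℝ}
    {f : Fin d → ℝ → ℝ} {B : ℝ → ℝ} {ε : ℝ}
    {u0e : (Fin d → ℝ) → ℝ} {u : (Fin d → ℝ) × ℝ → ℝ}

lemma aux_sol_cont (hT : 0 < T) (hu : IsSolution d Ω T f B ε u0e u) :
    ContinuousOn u (closure Ω ×ˢ Icc 0 T) := by
  have := hu.smooth.continuousOn
  rwa [closure_prod_eq, closure_Ioo hT.ne] at this

lemma aux_sol_cd (hΩ : IsOpen Ω) (hu : IsSolution d Ω T f B ε u0e u) {x : Fin d → ℝ} (hx : x ∈ Ω)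
    {t : ℝ} (ht : t ∈ Ioo 0 T) : ContDiffAt ℝ 2 u (x, t) :=
  hu.smooth.contDiffAt (mem_of_superset ((hΩ.prod isOpen_Ioo).mem_nhds ⟨hx, ht⟩) subset_closure)

lemma aux_sol_slice (hΩ : IsOpen Ω) (hu : IsSolution d Ω T f B ε u0e u) {x : Fin d → ℝ} (hx : x ∈ Ω)
    {t : ℝ} (ht : t ∈ Ioo 0 T) : ContDiffAt ℝ 2 (fun y => u (y, t)) x := by
  have h1 := aux_sol_cd hΩ hu hx ht
  exact ContDiffAt.comp (g := u) x h1 (contDiffAt_id.prodMk contDiffAt_const)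

lemma aux_sol_pde (hΩ : IsOpen Ω) (hu : IsSolution d Ω T f B ε u0e u) {x : Fin d → ℝ} (hx : x ∈ Ω)
    {t : ℝ} (ht : t ∈ Ioo 0 T) : pdT d u (x, t) =
      (ε * (B (u (x, t)) * lap d (fun y => u (y, t)) x
        + deriv B (u (x, t)) * ∑ j, pd d (fun y => u (y, t)) j x ^ 2)
      - ∑ j, deriv (f j) (u (x, t)) * pd d (fun y => u (y, t)) j x) := by
  have hpd : ∀ j, ∀ y ∈ Ω, pd d (fun y => u (y, t)) j y = pdX d u j (y, t) := by
    intro j y hy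
    exact aux_slice_fderiv ((aux_sol_cd hΩ hu hy ht).differentiableAt (by norm_num)) _
  have hpdd : ∀ j, pd d (pd d (fun y => u (y, t)) j) j x = pdXX d u j (x, t) := by
    intro j
    have he : pd d (fun y => u (y, t)) j =ᶠ[𝓝 x] fun y => pdX d u j (y, t) := by
      filter_upwards [hΩ.mem_nhds hx] with y hy using hpd j y hy
    rw [pd, he.fderiv_eq]
    have h1 : ContDiffAt ℝ 1 (fderiv ℝ u) (x, t) :=
      (aux_sol_cd hΩ hu hx ht).fderiv_right (by norm_num)
    have h2 : ContDiffAt ℝ 1 (pdX d u j) (x, t) := h1.clm_apply contDiffAt_const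
    exact aux_slice_fderiv (h2.differentiableAt (by norm_num)) _
  have := hu.pde x hx t ht
  simp only [lap, hpdd, hpd _ x hx]
  simp only [lapX] at this
  linarith

lemma aux_energy (hΩ : IsOpen Ω) (hb : Bornology.IsBounded Ω) (hT : 0 < T)
    (hu : IsSolution d Ω T f B ε u0e u) (hf : ∀ j, ContDiff ℝ 1 (f j))
    (hB : ContDiff ℝ 1 B) (hB0 : ∀ s, 0 ≤ B s) (hε : 0 ≤ ε)
    {S s1 : ℝ → ℝ} (hS : ∀ s, HasDerivAt S (s1 s) s) (hs1 : ContDiff ℝ 1 s1)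
    {κ : ℝ} (hκ : 0 < κ) (hs10 : ∀ s, |s| < κ → s1 s = 0)
    (hs1' : ∀ s, 0 ≤ deriv s1 s) {t : ℝ} (ht : t ∈ Ioo 0 T) :
    ∫ x in Ω, S (u (x, t)) ≤ ∫ x in Ω, S (u0e x) := by
  have huc := aux_sol_cont hT hu
  have hSc : Continuous S := continuous_iff_continuousAt.2 fun s => (hS s).continuousAt
  have hSC1 : ContDiff ℝ 1 S := by
    rw [contDiff_one_iff_deriv]
    refine ⟨fun s => (hS s).differentiableAt, ?_⟩
    rw [show deriv S = s1 from funext fun s => (hS s).deriv]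
    exact hs1.continuous
  have hPc : ContinuousOn (fun p => S (u p)) (closure Ω ×ˢ Icc 0 T) := hSc.comp_continuousOn huc
  set C : Set ((Fin d → ℝ) × ℝ) := (closure Ω ×ˢ Icc 0 T) ∩ (fun p => |u p|) ⁻¹' (Ici κ) with hCdef
  have hC : IsClosed C :=
    huc.abs.preimage_isClosed_of_isClosed (isClosed_closure.prod isClosed_Icc) isClosed_Ici
  have hCf : ∀ x ∈ frontier Ω, ∀ t ∈ Ioo 0 T, (x, t) ∉ C := by
    intro x hx s hs h
    have : κ ≤ |u (x, s)| := h.2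
    rw [hu.bdry x hx s hs] at this
    simp at this
    linarith
  have hlt : ∀ x ∈ Ω, ∀ s ∈ Ioo 0 T, (x, s) ∉ C → |u (x, s)| < κ := by
    intro x hx s hs h
    by_contra hh
    exact h ⟨⟨subset_closure hx, Ioo_subset_Icc_self hs⟩, not_lt.1 hh⟩
  have hpT : ∀ x ∈ Ω, ∀ s ∈ Ioo 0 T, pdT d (fun p => S (u p)) (x, s) = s1 (u (x, s)) * pdT d u (x, s) := by
    intro x hx s hs
    have h1 := (hS (u (x, s))).comp_hasFDerivAt (x, s)
      ((aux_sol_cd hΩ hu hx hs).differentiableAt (by norm_num)).hasFDerivAt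
    have h2 : fderiv ℝ (fun p => S (u p)) (x, s) = _ := h1.fderiv
    rw [pdT, h2]
    simp [pdT]
  have hder : ∀ s ∈ Ioo 0 T, HasDerivAt (fun t => ∫ x in Ω, S (u (x, t)))
      (∫ x in Ω, pdT d (fun p => S (u p)) (x, s)) s := fun s hs =>
    aux_E_deriv hΩ hb hPc (fun x hx s hs => hSC1.contDiffAt.comp (x, s)
      ((aux_sol_cd hΩ hu hx hs).of_le (by norm_num))) hC hCf
      (fun x hx s hs h => by rw [hpT x hx s hs, hs10 _ (hlt x hx s hs h), zero_mul]) hs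
  have hneg : ∀ s ∈ Ioo 0 T, ∫ x in Ω, pdT d (fun p => S (u p)) (x, s) ≤ 0 := by
    intro s hs
    have hK : IsCompact (closure Ω ∩ {x | (x, s) ∈ C}) :=
      hb.isCompact_closure.inter_right (hC.preimage (by fun_prop))
    have hKs : closure Ω ∩ {x | (x, s) ∈ C} ⊆ Ω := by
      rintro x ⟨h1, h2⟩
      by_contra hx
      exact hCf x (by rw [frontier, hΩ.interior_eq]; exact ⟨h1, hx⟩) s hs h2
    have := aux_energy_ibp hΩ hK hKs (w := fun y => u (y, s))
      (fun x hx => aux_sol_slice hΩ hu hx hs) (κ := κ)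
      (fun x hx h => hlt x hx s hs fun h' => h ⟨subset_closure hx, h'⟩) hf hB hB0 hε hs1 hs10 hs1'
    refine le_trans (le_of_eq ?_) this
    refine setIntegral_congr_fun hΩ.measurableSet fun x hx => ?_
    rw [hpT x hx s hs, aux_sol_pde hΩ hu hx hs]
  obtain ⟨c, hc, hc'⟩ := exists_hasDerivAt_eq_slope (fun t => ∫ x in Ω, S (u (x, t)))
    (fun s => ∫ x in Ω, pdT d (fun p => S (u p)) (x, s)) ht.1
    ((aux_E_cont hΩ hb hPc).mono (Icc_subset_Icc_right ht.2.le))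
    (fun s hs => hder s ⟨hs.1, hs.2.trans ht.2⟩)
  have h1 := hneg c ⟨hc.1, hc.2.trans ht.2⟩
  rw [hc', div_le_iff₀ (by linarith [ht.1])] at h1
  have h2 : ∫ x in Ω, S (u (x, 0)) = ∫ x in Ω, S (u0e x) :=
    setIntegral_congr_fun hΩ.measurableSet fun x hx => by simp only [hu.init x hx]
  linarith

lemma aux_weak (hΩ : IsOpen Ω) (hb : Bornology.IsBounded Ω) (hT : 0 < T)
    (hu : IsSolution d Ω T f B ε u0e u) (hf : ∀ j, ContDiff ℝ 1 (f j))
    (hB : ContDiff ℝ 1 B) {P : ℝ → ℝ} (hP : ContDiff ℝ 1 P) (hPd : ∀ s, HasDerivAt P (B s) s)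
    {φ : (Fin d → ℝ) → ℝ}
    (hφ : ContDiff ℝ 2 φ) (hφc : HasCompactSupport φ) (hφΩ : tsupport φ ⊆ Ω) {D : ℝ}
    (hD : ∀ x ∈ Ω, ∀ t ∈ Ioo 0 T, |(∑ j, f j (u (x, t)) * pd d φ j x)
      + ε * (P (u (x, t)) * lap d φ x)| ≤ D)
    {t : ℝ} (ht : t ∈ Ioo 0 T) :
    |(∫ x in Ω, φ x * u (x, t)) - ∫ x in Ω, φ x * u0e x| ≤ D * volume.real Ω * t := by
  have := aux_fin hb
  have huc := aux_sol_cont hT hu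
  have hPc : ContinuousOn (fun p : (Fin d → ℝ) × ℝ => φ p.1 * u p) (closure Ω ×ˢ Icc 0 T) :=
    (hφ.continuous.comp continuous_fst).continuousOn.mul huc
  have hC : IsClosed (tsupport φ ×ˢ (univ : Set ℝ)) := (isClosed_tsupport φ).prod isClosed_univ
  have hpT : ∀ x ∈ Ω, ∀ s ∈ Ioo 0 T,
      pdT d (fun p => φ p.1 * u p) (x, s) = φ x * pdT d u (x, s) := by
    intro x hx s hs
    have h0 := ((aux_sol_cd hΩ hu hx hs).differentiableAt (by norm_num))
    have h3 : DifferentiableAt ℝ (fun p : (Fin d → ℝ) × ℝ => φ p.1 * u p) (x, s) := by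
      refine DifferentiableAt.mul ?_ h0
      exact DifferentiableAt.comp (x, s) (hφ.contDiffAt.differentiableAt (by norm_num)) differentiableAt_fst
    exact (aux_slice_time h3).unique ((aux_slice_time h0).const_mul (φ x))
  have hder : ∀ s ∈ Ioo 0 T, HasDerivAt (fun t => ∫ x in Ω, φ x * u (x, t))
      (∫ x in Ω, pdT d (fun p => φ p.1 * u p) (x, s)) s := fun s hs =>
    aux_E_deriv hΩ hb hPc (fun x hx s hs => by
        refine ContDiffAt.mul ?_ ((aux_sol_cd hΩ hu hx hs).of_le (by norm_num))
        exact ContDiffAt.comp (x, s) (hφ.contDiffAt.of_le (by norm_num)) contDiffAt_fst) hC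
      (fun x hx s hs h => by
        have := hφΩ h.1
        rw [frontier, hΩ.interior_eq] at hx
        exact hx.2 this)
      (fun x hx s hs h => by
        rw [hpT x hx s hs, image_eq_zero_of_notMem_tsupport (fun h' => h ⟨h', mem_univ _⟩), zero_mul]) hs
  have hpdc : ∀ j, ContDiff ℝ 1 (pd d φ j) := fun j =>
    contDiff_iff_contDiffAt.2 fun x => aux_pd_contDiffAt hφ.contDiffAt j
  have hlapc : Continuous (lap d φ) := by
    unfold lap
    refine continuous_finsetSum _ fun j _ => ?_
    exact ((hpdc j).continuous_fderiv (by norm_num)).clm_apply continuous_const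
  have hbound : ∀ s ∈ Ioo 0 T, |∫ x in Ω, pdT d (fun p => φ p.1 * u p) (x, s)|
      ≤ D * volume.real Ω := by
    intro s hs
    have hsc : ContinuousOn (fun x => u (x, s)) Ω :=
      (aux_slice_cont huc (Ioo_subset_Icc_self hs)).mono subset_closure
    have hI : IntegrableOn (fun x => (∑ j, f j (u (x, s)) * pd d φ j x)
        + ε * (P (u (x, s)) * lap d φ x)) Ω := by
      refine (integrable_const D).mono' ?_ ?_
      · refine ContinuousOn.aestronglyMeasurable ?_ hΩ.measurableSet
        refine ContinuousOn.add (continuousOn_finsetSum _ fun j _ => ?_) ?_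
        · exact ((hf j).continuous.comp_continuousOn hsc).mul (hpdc j).continuous.continuousOn
        · exact continuousOn_const.mul ((hP.continuous.comp_continuousOn hsc).mul hlapc.continuousOn)
      · filter_upwards [ae_restrict_mem hΩ.measurableSet] with x hx
        exact hD x hx s hs
    have h1 := aux_weak_ibp hΩ (w := fun y => u (y, s)) (fun x hx => aux_sol_slice hΩ hu hx hs)
      hφ hφc hφΩ hf hB hP hPd hI
    rw [setIntegral_congr_fun hΩ.measurableSet fun x hx => by
      rw [hpT x hx s hs, aux_sol_pde hΩ hu hx hs], h1]
    have := norm_setIntegral_le_of_norm_le_const (μ := volume) (s := Ω) (C := D) hb.measure_lt_top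
      (f := fun x => (∑ j, f j (u (x, s)) * pd d φ j x) + ε * (P (u (x, s)) * lap d φ x))
      (fun x hx => hD x hx s hs)
    exact this
  obtain ⟨c, hc, hc'⟩ := exists_hasDerivAt_eq_slope (fun t => ∫ x in Ω, φ x * u (x, t))
    (fun s => ∫ x in Ω, pdT d (fun p => φ p.1 * u p) (x, s)) ht.1
    ((aux_E_cont hΩ hb hPc).mono (Icc_subset_Icc_right ht.2.le))
    (fun s hs => hder s ⟨hs.1, hs.2.trans ht.2⟩)
  have h1 := hbound c ⟨hc.1, hc.2.trans ht.2⟩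
  rw [hc', sub_zero, abs_div, abs_of_pos ht.1, div_le_iff₀ ht.1] at h1
  have h2 : ∫ x in Ω, φ x * u (x, 0) = ∫ x in Ω, φ x * u0e x :=
    setIntegral_congr_fun hΩ.measurableSet fun x hx => by simp only [hu.init x hx]
  rwa [h2] at h1

end sol


lemma aux_supp {d : ℕ} {ρ : (Fin d → ℝ) → ℝ} (hρ : IsMollifier d ρ) {ε : ℝ} (hε : 0 < ε)
    {z : Fin d → ℝ} (hz : ρ (ε⁻¹ • z) ≠ 0) : ‖z‖ ≤ ε := by
  have h1 := hρ.2.2.2.1 _ hz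
  have h2 : ‖ε⁻¹ • z‖ ≤ 1 := by
    rw [pi_norm_le_iff_of_nonneg zero_le_one]
    intro j
    have h3 : ((ε⁻¹ • z) j) ^ 2 ≤ 1 :=
      (Finset.single_le_sum (f := fun j => ((ε⁻¹ • z) j) ^ 2) (fun i _ => sq_nonneg _)
        (Finset.mem_univ j)).trans h1
    rw [Real.norm_eq_abs]
    exact (sq_le_one_iff_abs_le_one _).1 h3
  rw [norm_smul, norm_inv, Real.norm_eq_abs, abs_of_pos hε, inv_mul_le_iff₀ hε, mul_one] at h2
  exact h2

lemma aux_ker_int {d : ℕ} {ρ : (Fin d → ℝ) → ℝ} (hρ : IsMollifier d ρ) {ε : ℝ} (hε : 0 < ε)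
    (x : Fin d → ℝ) :
    Integrable (fun y => (ε ^ d)⁻¹ * ρ (ε⁻¹ • (x - y))) ∧
    ∫ y, (ε ^ d)⁻¹ * ρ (ε⁻¹ • (x - y)) = 1 := by
  have hint : Integrable ρ := hρ.1.continuous.integrable_of_hasCompactSupport hρ.2.1
  constructor
  · have h1 : Integrable (fun z => ρ (ε⁻¹ • z)) := hint.comp_smul (inv_ne_zero hε.ne')
    exact (h1.comp_sub_left x).const_mul _
  · rw [integral_const_mul, integral_sub_left_eq_self (fun z => ρ (ε⁻¹ • z)) volume x,
      Measure.integral_comp_smul, hρ.2.2.2.2]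
    simp
    rw [abs_of_pos hε]
    field_simp

lemma aux_moll_bdd {d : ℕ} {ρ : (Fin d → ℝ) → ℝ} (hρ : IsMollifier d ρ) {ε : ℝ} (hε : 0 < ε)
    {v : (Fin d → ℝ) → ℝ} {M : ℝ} (hM : ∀ᵐ x, |v x| ≤ M) (x : Fin d → ℝ) :
    |mollify d ρ ε v x| ≤ M := by
  obtain ⟨h1, h2⟩ := aux_ker_int hρ hε x
  have h3 : ‖∫ y, v y * ((ε ^ d)⁻¹ * ρ (ε⁻¹ • (x - y)))‖ ≤
      ∫ y, M * ((ε ^ d)⁻¹ * ρ (ε⁻¹ • (x - y))) := by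
    refine norm_integral_le_of_norm_le (h1.const_mul M) ?_
    filter_upwards [hM] with y hy
    have : 0 ≤ (ε ^ d)⁻¹ * ρ (ε⁻¹ • (x - y)) := mul_nonneg (by positivity) (hρ.2.2.1 _)
    rw [norm_mul, Real.norm_eq_abs, Real.norm_of_nonneg this]
    gcongr
  rw [integral_const_mul, h2, mul_one] at h3
  exact h3

lemma aux_moll_smooth {d : ℕ} {ρ : (Fin d → ℝ) → ℝ} (hρ : IsMollifier d ρ) {ε : ℝ} (hε : 0 < ε)
    {v : (Fin d → ℝ) → ℝ} (hv : Integrable v) : ContDiff ℝ 2 (mollify d ρ ε v) := by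
  have h1 : ContDiff ℝ 2 (fun z => (ε ^ d)⁻¹ * ρ (ε⁻¹ • z)) := by
    have : ContDiff ℝ 2 ρ := hρ.1.of_le (WithTop.coe_le_coe.2 (le_top : (2:ℕ∞) ≤ ⊤))
    exact contDiff_const.mul (this.comp (contDiff_const_smul _))
  have h2 : HasCompactSupport (fun z => (ε ^ d)⁻¹ * ρ (ε⁻¹ • z)) := by
    refine HasCompactSupport.intro (isCompact_closedBall (0 : Fin d → ℝ) ε) ?_
    intro z hz
    by_contra h
    exact hz (by simpa using aux_supp hρ hε (right_ne_zero_of_mul h))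
  exact h2.contDiff_convolution_right (ContinuousLinearMap.mul ℝ ℝ) (μ := volume)
    hv.locallyIntegrable h1

lemma aux_moll_supp {d : ℕ} {ρ : (Fin d → ℝ) → ℝ} (hρ : IsMollifier d ρ) {ε : ℝ} (hε : 0 < ε)
    {v : (Fin d → ℝ) → ℝ} {K : Set (Fin d → ℝ)} (hK : ∀ᵐ x, x ∉ K → v x = 0)
    {x : Fin d → ℝ} (hx : x ∉ Metric.cthickening ε K) : mollify d ρ ε v x = 0 := by
  refine integral_eq_zero_of_ae ?_
  filter_upwards [hK] with y hy
  by_cases hyK : y ∈ K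
  · have : ρ (ε⁻¹ • (x - y)) = 0 := by
      by_contra h
      exact hx (Metric.mem_cthickening_of_dist_le x y ε K hyK
        (by rw [dist_eq_norm]; exact aux_supp hρ hε h))
    simp [this]
  · simp [hy hyK]

lemma aux_moll_ae {d : ℕ} {ρ : (Fin d → ℝ) → ℝ} (hρ : IsMollifier d ρ) {εs : ℕ → ℝ}
    (hεs : ∀ k, 0 < εs k) (hεlim : Tendsto εs atTop (nhds 0))
    {v : (Fin d → ℝ) → ℝ} (hv : Integrable v) :
    ∀ᵐ x, Tendsto (fun k => mollify d ρ (εs k) v x) atTop (𝓝 (v x)) := by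
  obtain ⟨R, hR⟩ := hρ.2.1.exists_bound_of_continuous hρ.1.continuous
  filter_upwards [IsUnifLocDoublingMeasure.ae_tendsto_average_norm_sub (μ := volume)
    hv.locallyIntegrable 1] with x hx
  have h1 := hx (l := atTop) (fun _ : ℕ => x) εs
    (tendsto_nhdsWithin_iff.2 ⟨hεlim, Eventually.of_forall hεs⟩)
    (Eventually.of_forall fun k => by simp [(hεs k).le])
  have h2 := h1.const_mul (R * 2 ^ d)
  rw [mul_zero] at h2
  rw [tendsto_iff_norm_sub_tendsto_zero]
  refine squeeze_zero (fun _ => norm_nonneg _) (fun k => ?_) h2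
  have hε := hεs k
  set ε := εs k
  obtain ⟨i1, i2⟩ := aux_ker_int hρ hε x
  have hR0 : 0 ≤ R := (norm_nonneg _).trans (hR 0)
  have i3 : Integrable (fun y => v y * ((ε ^ d)⁻¹ * ρ (ε⁻¹ • (x - y)))) := by
    refine hv.mul_bdd (c := (ε ^ d)⁻¹ * R) i1.aestronglyMeasurable ?_
    refine Eventually.of_forall fun y => ?_
    rw [norm_mul, Real.norm_of_nonneg (show 0 ≤ (ε ^ d)⁻¹ by positivity)]
    gcongr
    exact hR _
  have e1 : mollify d ρ ε v x - v x = ∫ y, (v y - v x) * ((ε ^ d)⁻¹ * ρ (ε⁻¹ • (x - y))) := by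
    simp only [sub_mul]
    rw [integral_sub i3 (i1.const_mul _), integral_const_mul, i2, mul_one]
    rfl
  have e2 : ∫ y, (v y - v x) * ((ε ^ d)⁻¹ * ρ (ε⁻¹ • (x - y)))
      = ∫ y in Metric.closedBall x ε, (v y - v x) * ((ε ^ d)⁻¹ * ρ (ε⁻¹ • (x - y))) := by
    rw [setIntegral_eq_integral_of_forall_compl_eq_zero]
    intro y hy
    have : ρ (ε⁻¹ • (x - y)) = 0 := by
      by_contra h
      exact hy (by rw [Metric.mem_closedBall, dist_comm, dist_eq_norm]; exact aux_supp hρ hε h)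
    simp [this]
  have e3 : IntegrableOn (fun y => ‖v y - v x‖) (Metric.closedBall x ε) := by
    refine (Integrable.sub hv.integrableOn ?_).norm
    exact integrableOn_const (hs := (isCompact_closedBall x ε).measure_lt_top.ne)
  have e4 : ‖∫ y in Metric.closedBall x ε, (v y - v x) * ((ε ^ d)⁻¹ * ρ (ε⁻¹ • (x - y)))‖
      ≤ ∫ y in Metric.closedBall x ε, ((ε ^ d)⁻¹ * R) * ‖v y - v x‖ := by
    refine norm_integral_le_of_norm_le (e3.const_mul _) (Eventually.of_forall fun y => ?_)
    rw [norm_mul, mul_comm, norm_mul, Real.norm_of_nonneg (show 0 ≤ (ε ^ d)⁻¹ by positivity)]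
    gcongr
    exact hR _
  rw [e1, e2]
  refine e4.trans (le_of_eq ?_)
  rw [integral_const_mul, setAverage_eq, measureReal_def, Real.volume_pi_closedBall x hε.le,
    ENNReal.toReal_ofReal (by positivity)]
  simp only [smul_eq_mul, Fintype.card_fin, mul_pow]
  field_simp


lemma aux_maxpow (n : ℕ) (y : ℝ) :
    HasDerivAt (fun y : ℝ => max y 0 ^ (n + 2)) (((n + 2 : ℕ) : ℝ) * max y 0 ^ (n + 1)) y := by
  have hne : ∀ y : ℝ, y ≠ 0 →
      HasDerivAt (fun y : ℝ => max y 0 ^ (n + 2)) (((n + 2 : ℕ) : ℝ) * max y 0 ^ (n + 1)) y := by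
    intro y hy
    rcases lt_or_gt_of_ne hy with h | h
    · have he : (fun y : ℝ => max y 0 ^ (n + 2)) =ᶠ[𝓝 y] fun _ => 0 := by
        filter_upwards [isOpen_Iio.mem_nhds h] with z hz
        simp [max_eq_right (mem_Iio.1 hz).le]
      rw [max_eq_right h.le]
      simpa using (hasDerivAt_const y (0:ℝ)).congr_of_eventuallyEq he
    · have he : (fun y : ℝ => max y 0 ^ (n + 2)) =ᶠ[𝓝 y] fun y => y ^ (n + 2) := by
        filter_upwards [isOpen_Ioi.mem_nhds h] with z hz
        rw [max_eq_left (mem_Ioi.1 hz).le]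
      rw [max_eq_left h.le]
      exact (hasDerivAt_pow (n + 2) y).congr_of_eventuallyEq he
  by_cases hy : y = 0
  · subst hy
    exact hasDerivAt_of_hasDerivAt_of_ne (x := 0)
      (g := fun y : ℝ => ((n + 2 : ℕ) : ℝ) * max y 0 ^ (n + 1)) (fun z hz => hne z hz)
      (by fun_prop) (by fun_prop)
  · exact hne y hy

lemma aux_S (κ : ℝ) (hκ : 0 < κ) : ∃ S s1 : ℝ → ℝ, (∀ s, S s = max (s ^ 2 - κ ^ 2) 0 ^ 3) ∧
    (∀ s, HasDerivAt S (s1 s) s) ∧ ContDiff ℝ 1 s1 ∧ (∀ s, |s| < κ → s1 s = 0) ∧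
    ∀ s, 0 ≤ deriv s1 s := by
  have hq : ∀ s : ℝ, HasDerivAt (fun s : ℝ => s ^ 2 - κ ^ 2) (2 * s) s := fun s => by
    simpa using (hasDerivAt_pow 2 s).sub_const (κ ^ 2)
  have h1 : ∀ s : ℝ, HasDerivAt (fun s : ℝ => max (s ^ 2 - κ ^ 2) 0 ^ 3)
      (3 * max (s ^ 2 - κ ^ 2) 0 ^ 2 * (2 * s)) s := fun s => by
    have := (aux_maxpow 1 (s ^ 2 - κ ^ 2)).comp s (hq s)
    exact this.congr_deriv (by norm_num)
  have h2 : ∀ s : ℝ, HasDerivAt (fun s : ℝ => 3 * max (s ^ 2 - κ ^ 2) 0 ^ 2 * (2 * s))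
      (3 * (2 * max (s ^ 2 - κ ^ 2) 0 * (2 * s)) * (2 * s) + 3 * max (s ^ 2 - κ ^ 2) 0 ^ 2 * 2) s := by
    intro s
    have h3 : HasDerivAt (fun s : ℝ => max (s ^ 2 - κ ^ 2) 0 ^ 2)
        (2 * max (s ^ 2 - κ ^ 2) 0 * (2 * s)) s := by
      have := (aux_maxpow 0 (s ^ 2 - κ ^ 2)).comp s (hq s)
      exact this.congr_deriv (by norm_num)
    have h4 : HasDerivAt (fun s : ℝ => 2 * s) 2 s := by
      simpa using (hasDerivAt_id s).const_mul 2
    exact (h3.const_mul 3).mul h4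
  refine ⟨_, _, fun s => rfl, h1, ?_, ?_, ?_⟩
  · rw [contDiff_one_iff_deriv]
    refine ⟨fun s => (h2 s).differentiableAt, ?_⟩
    rw [show deriv _ = _ from funext fun s => (h2 s).deriv]
    fun_prop
  · intro s hs
    have : s ^ 2 - κ ^ 2 ≤ 0 := by
      have := sq_lt_sq' (abs_lt.1 hs).1 (abs_lt.1 hs).2
      linarith
    simp [max_eq_right this]
  · intro s
    rw [(h2 s).deriv]
    have : 0 ≤ max (s ^ 2 - κ ^ 2) 0 := le_max_right _ _
    have h5 : 3 * (2 * max (s ^ 2 - κ ^ 2) 0 * (2 * s)) * (2 * s) =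
      24 * max (s ^ 2 - κ ^ 2) 0 * s ^ 2 := by ring
    rw [h5]
    positivity

lemma aux_convex6 (a b : ℝ) : (a - b) ^ 6 ≤ 16 * (a ^ 6 - b ^ 6 - 6 * (b ^ 5 * (a - b))) := by
  have h : (a - b) ^ 4 ≤ 16 * (a ^ 4 + 2 * a ^ 3 * b + 3 * a ^ 2 * b ^ 2 + 4 * a * b ^ 3 + 5 * b ^ 4) := by
    nlinarith [sq_nonneg (15 * a ^ 2 + 18 * a * b), sq_nonneg (15 * a ^ 2 + 18 * a * b - b ^ 2),
      sq_nonneg (15 * a ^ 2 + 18 * a * b + 4 * b ^ 2), sq_nonneg (15 * a ^ 2 + 18 * a * b + 8 * b ^ 2),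
      sq_nonneg (a * b), sq_nonneg (b ^ 2), sq_nonneg (a * b + b ^ 2), sq_nonneg (a * b + 2 * b ^ 2),
      sq_nonneg (2 * a * b + 3 * b ^ 2)]
  have h2 := mul_le_mul_of_nonneg_left h (sq_nonneg (a - b))
  nlinarith [h2]

lemma aux_young (η y : ℝ) (hη : 0 < η) : |y| ≤ η + (η ^ 5)⁻¹ * y ^ 6 := by
  have h6 : y ^ 6 = |y| ^ 6 := by rw [← abs_pow, abs_of_nonneg (by positivity)]
  rcases le_total |y| η with h | h
  · have : 0 ≤ (η ^ 5)⁻¹ * y ^ 6 := by rw [h6]; positivity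
    linarith
  · have h5 : η ^ 5 ≤ |y| ^ 5 := by gcongr
    have : |y| ≤ (η ^ 5)⁻¹ * y ^ 6 := by
      rw [h6, le_inv_mul_iff₀ (by positivity)]
      calc η ^ 5 * |y| ≤ |y| ^ 5 * |y| := by gcongr
        _ = |y| ^ 6 := by ring
    linarith

lemma aux_bint {α : Type*} [MeasurableSpace α] {μ : Measure α} [IsFiniteMeasure μ] {g : α → ℝ}
    (hg : AEStronglyMeasurable g μ) {R : ℝ} (hR : ∀ᵐ x ∂μ, |g x| ≤ R) : Integrable g μ :=
  (integrable_const R).mono' hg hR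

lemma aux_final {α : Type*} [MeasurableSpace α] {μ : Measure α} [IsFiniteMeasure μ]
    {a b φ : α → ℝ} (ha : AEStronglyMeasurable a μ) (hb : AEStronglyMeasurable b μ)
    (hφ : AEStronglyMeasurable φ μ) {M R A η : ℝ} (hM : 0 ≤ M)
    (haM : ∀ᵐ x ∂μ, |a x| ≤ M) (hbM : ∀ᵐ x ∂μ, |b x| ≤ M) (hφR : ∀ᵐ x ∂μ, |φ x| ≤ R)
    (h6 : ∫ x, a x ^ 6 ∂μ ≤ ∫ x, b x ^ 6 ∂μ)
    (hA : |∫ x, φ x * a x ∂μ - ∫ x, φ x * b x ∂μ| ≤ A) (hη : 0 < η) :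
    ∫ x, |a x - b x| ∂μ ≤ η * μ.real univ
      + (η ^ 5)⁻¹ * (96 * (2 * M * ∫ x, |b x ^ 5 - φ x| ∂μ + A)) := by
  have ia : Integrable a μ := aux_bint ha haM
  have ib : Integrable b μ := aux_bint hb hbM
  have hpow : ∀ {g : α → ℝ} (n : ℕ), AEStronglyMeasurable g μ → (∀ᵐ x ∂μ, |g x| ≤ M) →
      Integrable (fun x => g x ^ n) μ := by
    intro g n hg hgM
    refine aux_bint (R := M ^ n) (hg.pow n) ?_
    filter_upwards [hgM] with x hx
    rw [abs_pow]
    gcongr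
  have iφ : Integrable φ μ := aux_bint hφ hφR
  have hab : ∀ᵐ x ∂μ, |a x - b x| ≤ 2 * M := by
    filter_upwards [haM, hbM] with x h1 h2
    have := abs_sub (a x) (b x)
    linarith
  have i1 : Integrable (fun x => |b x ^ 5 - φ x|) μ := ((hpow 5 hb hbM).sub iφ).abs
  have i2 : Integrable (fun x => b x ^ 5 * (a x - b x)) μ :=
    (hpow 5 hb hbM).mul_bdd (c := 2 * M) (ha.sub hb) hab
  have i3 : Integrable (fun x => (b x ^ 5 - φ x) * (a x - b x)) μ :=
    ((hpow 5 hb hbM).sub iφ).mul_bdd (c := 2 * M) (ha.sub hb) hab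
  have i4 : Integrable (fun x => φ x * a x) μ := iφ.mul_bdd (c := M) ha haM
  have i5 : Integrable (fun x => φ x * b x) μ := iφ.mul_bdd (c := M) hb hbM
  have e1 : ∫ x, b x ^ 5 * (a x - b x) ∂μ = ∫ x, (b x ^ 5 - φ x) * (a x - b x) ∂μ
      + (∫ x, φ x * a x ∂μ - ∫ x, φ x * b x ∂μ) := by
    have i45 : Integrable (fun x => φ x * a x - φ x * b x) μ := i4.sub i5
    rw [← integral_sub i4 i5, ← integral_add i3 i45]
    congr 1
    ext x
    ring
  have e2 : |∫ x, (b x ^ 5 - φ x) * (a x - b x) ∂μ| ≤ 2 * M * ∫ x, |b x ^ 5 - φ x| ∂μ := by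
    rw [← integral_const_mul, ← Real.norm_eq_abs]
    refine norm_integral_le_of_norm_le (i1.const_mul _) ?_
    filter_upwards [hab] with x hx
    rw [norm_mul, mul_comm]
    exact mul_le_mul_of_nonneg_right hx (abs_nonneg _)
  have e3 : -(2 * M * ∫ x, |b x ^ 5 - φ x| ∂μ + A) ≤ ∫ x, b x ^ 5 * (a x - b x) ∂μ := by
    rw [e1]
    have := (abs_le.1 e2).1
    have := (abs_le.1 hA).1
    linarith
  have i6 : Integrable (fun x => a x ^ 6 - b x ^ 6 - 6 * (b x ^ 5 * (a x - b x))) μ :=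
    ((hpow 6 ha haM).sub (hpow 6 hb hbM)).sub (i2.const_mul 6)
  have e4 : ∫ x, |a x - b x| ∂μ ≤ ∫ x, (η + (η ^ 5)⁻¹ *
      (16 * (a x ^ 6 - b x ^ 6 - 6 * (b x ^ 5 * (a x - b x))))) ∂μ := by
    refine integral_mono (ia.sub ib).abs
      ((integrable_const _).add ((i6.const_mul 16).const_mul _)) fun x => ?_
    refine (aux_young η (a x - b x) hη).trans ?_
    have := aux_convex6 (a x) (b x)
    gcongr
  have i66 : Integrable (fun x => a x ^ 6 - b x ^ 6) μ := (hpow 6 ha haM).sub (hpow 6 hb hbM)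
  rw [integral_add (integrable_const _) ((i6.const_mul 16).const_mul _), integral_const_mul,
    integral_const_mul, integral_sub i66 (i2.const_mul 6),
    integral_sub (hpow 6 ha haM) (hpow 6 hb hbM), integral_const_mul, integral_const,
    smul_eq_mul, mul_comm (μ.real univ)] at e4
  refine e4.trans ?_
  refine add_le_add le_rfl (mul_le_mul_of_nonneg_left ?_ (by positivity))
  linarith


lemma aux_linf {d : ℕ} {Ω : Set (Fin d → ℝ)} {T : ℝ} {f : Fin d → ℝ → ℝ} {B : ℝ → ℝ} {ε : ℝ}
    {u0e : (Fin d → ℝ) → ℝ} {u : (Fin d → ℝ) × ℝ → ℝ}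
    (hΩ : IsOpen Ω) (hb : Bornology.IsBounded Ω) (hT : 0 < T)
    (hu : IsSolution d Ω T f B ε u0e u) (hf : ∀ j, ContDiff ℝ 1 (f j))
    (hB : ContDiff ℝ 1 B) (hB0 : ∀ s, 0 ≤ B s) (hε : 0 ≤ ε)
    {M : ℝ} (hM : 0 < M) (hu0 : ∀ x, |u0e x| ≤ M) {x : Fin d → ℝ} (hx : x ∈ Ω)
    {t : ℝ} (ht : t ∈ Ioo 0 T) : |u (x, t)| ≤ M := by
  obtain ⟨S, s1, hS0, hS, hs1, hs10, hs1'⟩ := aux_S M hM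
  have hfin := aux_fin hb
  have hE := aux_energy hΩ hb hT hu hf hB hB0 hε hS hs1 hM hs10 hs1' ht
  have h0 : ∀ x, S (u0e x) = 0 := fun x => by
    rw [hS0, max_eq_right, zero_pow (by norm_num)]
    have := sq_le_sq' (abs_le.1 (hu0 x)).1 (abs_le.1 (hu0 x)).2
    linarith
  simp only [h0, integral_zero] at hE
  have hSc : Continuous S := continuous_iff_continuousAt.2 fun s => (hS s).continuousAt
  have hc : ContinuousOn (fun x => S (u (x, t))) (closure Ω) :=
    hSc.comp_continuousOn (aux_slice_cont (aux_sol_cont hT hu) (Ioo_subset_Icc_self ht))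
  have hi : IntegrableOn (fun x => S (u (x, t))) Ω :=
    (hc.integrableOn_compact hb.isCompact_closure).mono_set subset_closure
  have hnn : ∀ x, 0 ≤ S (u (x, t)) := fun x => by rw [hS0]; positivity
  have h1 : ∫ x in Ω, S (u (x, t)) = 0 := le_antisymm hE (integral_nonneg hnn)
  have h2 := (integral_eq_zero_iff_of_nonneg hnn hi).1 h1
  have h3 := Measure.eqOn_open_of_ae_eq h2 hΩ (hc.mono subset_closure) continuousOn_const hx
  have h4 : S (u (x, t)) = 0 := h3
  rw [hS0] at h4
  have h5 := eq_zero_of_pow_eq_zero h4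
  have h6 : u (x, t) ^ 2 ≤ M ^ 2 := by
    have := le_max_left (u (x, t) ^ 2 - M ^ 2) 0
    linarith
  exact abs_le_of_sq_le_sq h6 hM.le

lemma aux_six {d : ℕ} {Ω : Set (Fin d → ℝ)} {T : ℝ} {f : Fin d → ℝ → ℝ} {B : ℝ → ℝ} {ε : ℝ}
    {u0e : (Fin d → ℝ) → ℝ} {u : (Fin d → ℝ) × ℝ → ℝ}
    (hΩ : IsOpen Ω) (hb : Bornology.IsBounded Ω) (hT : 0 < T)
    (hu : IsSolution d Ω T f B ε u0e u) (hf : ∀ j, ContDiff ℝ 1 (f j))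
    (hB : ContDiff ℝ 1 B) (hB0 : ∀ s, 0 ≤ B s) (hε : 0 ≤ ε)
    {M : ℝ} (hM : 0 < M) (hu0c : Continuous u0e) (hu0 : ∀ x, |u0e x| ≤ M)
    {t : ℝ} (ht : t ∈ Ioo 0 T) : ∫ x in Ω, u (x, t) ^ 6 ≤ ∫ x in Ω, u0e x ^ 6 := by
  have hfin := aux_fin hb
  have key : ∀ g : (Fin d → ℝ) → ℝ, ContinuousOn g Ω → (∀ x ∈ Ω, |g x| ≤ M) →
      Tendsto (fun n : ℕ => ∫ x in Ω, max (g x ^ 2 - (1 / ((n : ℝ) + 1)) ^ 2) 0 ^ 3) atTop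
        (𝓝 (∫ x in Ω, g x ^ 6)) := by
    intro g hgc hgM
    refine tendsto_integral_of_dominated_convergence (fun _ => M ^ 6) ?_ (integrable_const _) ?_ ?_
    · intro n
      refine ContinuousOn.aestronglyMeasurable ?_ hΩ.measurableSet
      exact (((hgc.pow 2).sub continuousOn_const).sup continuousOn_const).pow 3
    · intro n
      filter_upwards [ae_restrict_mem hΩ.measurableSet] with x hx
      have h1 : 0 ≤ max (g x ^ 2 - (1 / ((n : ℝ) + 1)) ^ 2) 0 := le_max_right _ _
      have h2 : max (g x ^ 2 - (1 / ((n : ℝ) + 1)) ^ 2) 0 ≤ M ^ 2 := by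
        refine max_le ?_ (by positivity)
        have := sq_le_sq' (abs_le.1 (hgM x hx)).1 (abs_le.1 (hgM x hx)).2
        have := sq_nonneg (1 / ((n : ℝ) + 1))
        linarith
      rw [Real.norm_of_nonneg (by positivity)]
      calc _ ≤ (M ^ 2) ^ 3 := by gcongr
        _ = M ^ 6 := by ring
    · refine Eventually.of_forall fun x => ?_
      have h1 : Tendsto (fun n : ℕ => (1 / ((n : ℝ) + 1))) atTop (𝓝 0) :=
        tendsto_one_div_add_atTop_nhds_zero_nat
      have h2 : Continuous (fun y : ℝ => max (g x ^ 2 - y ^ 2) 0 ^ 3) := by fun_prop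
      have h3 := (h2.tendsto 0).comp h1
      have h4 : max (g x ^ 2 - (0:ℝ) ^ 2) 0 ^ 3 = g x ^ 6 := by
        rw [zero_pow (by norm_num), sub_zero, max_eq_left (sq_nonneg _)]
        ring
      rw [h4] at h3
      exact h3
  refine le_of_tendsto_of_tendsto'
    (key (fun x => u (x, t)) ((aux_slice_cont (aux_sol_cont hT hu)
      (Ioo_subset_Icc_self ht)).mono subset_closure)
      fun x hx => aux_linf hΩ hb hT hu hf hB hB0 hε hM hu0 hx ht)
    (key u0e hu0c.continuousOn fun x _ => hu0 x) fun n => ?_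
  have hκ : 0 < 1 / ((n : ℝ) + 1) := by positivity
  obtain ⟨S, s1, hS0, hS, hs1, hs10, hs1'⟩ := aux_S _ hκ
  have hE := aux_energy hΩ hb hT hu hf hB hB0 hε hS hs1 hκ hs10 hs1' ht
  simpa only [hS0] using hE

lemma aux_D {d : ℕ} {Ω : Set (Fin d → ℝ)} (hb : Bornology.IsBounded Ω) {f : Fin d → ℝ → ℝ}
    (hf : ∀ j, ContDiff ℝ 1 (f j)) {P : ℝ → ℝ} (hP : Continuous P) {φ : (Fin d → ℝ) → ℝ}
    (hφ : ContDiff ℝ 2 φ) (E M : ℝ) :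
    ∃ D, 0 ≤ D ∧ ∀ ε ∈ Icc 0 E, ∀ s, |s| ≤ M → ∀ x ∈ Ω,
      |(∑ j, f j s * pd d φ j x) + ε * (P s * lap d φ x)| ≤ D := by
  have hpd : ∀ j, ContDiff ℝ 1 (pd d φ j) := fun j =>
    contDiff_iff_contDiffAt.2 fun x => aux_pd_contDiffAt hφ.contDiffAt j
  have hpdc : ∀ j, Continuous (pd d φ j) := fun j => (hpd j).continuous
  have hlapc : Continuous (lap d φ) := by
    refine continuous_finsetSum _ fun j _ => ?_
    exact ((hpd j).continuous_fderiv (by norm_num)).clm_apply continuous_const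
  have hfc : ∀ j, Continuous (f j) := fun j => (hf j).continuous
  have hc : Continuous (fun p : ℝ × ℝ × (Fin d → ℝ) =>
      (∑ j, f j p.2.1 * pd d φ j p.2.2) + p.1 * (P p.2.1 * lap d φ p.2.2)) := by
    fun_prop
  obtain ⟨D, hD⟩ := ((isCompact_Icc (a := (0:ℝ)) (b := E)).prod
    ((isCompact_Icc (a := -M) (b := M)).prod hb.isCompact_closure)).exists_bound_of_continuousOn
    hc.continuousOn
  refine ⟨max D 0, le_max_right _ _, fun ε hε s hs x hx => le_max_of_le_left ?_⟩
  exact hD (ε, s, x) ⟨hε, abs_le.1 hs, subset_closure hx⟩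

lemma aux_slices {d : ℕ} {Ω : Set (Fin d → ℝ)} {T : ℝ} {q : (Fin d → ℝ) × ℝ → Prop}
    (h : ∀ᵐ p ∂(volume.restrict (Ω ×ˢ Ioo (0:ℝ) T)), q p) :
    ∀ᵐ t ∂(volume.restrict (Ioo (0:ℝ) T)), ∀ᵐ x ∂(volume.restrict Ω), q (x, t) := by
  rw [Measure.volume_eq_prod, ← Measure.prod_restrict] at h
  exact Measure.ae_ae_of_ae_prod (Measure.measurePreserving_swap.quasiMeasurePreserving.ae h)


lemma aux_dct_s14 {α : Type*} [MeasurableSpace α] {μ : Measure α} [IsFiniteMeasure μ]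
    {F : ℕ → α → ℝ} {g : α → ℝ} (hF : ∀ n, AEStronglyMeasurable (F n) μ) {R : ℝ}
    (hR : ∀ n, ∀ᵐ x ∂μ, |F n x| ≤ R)
    (hl : ∀ᵐ x ∂μ, Tendsto (fun n => F n x) atTop (𝓝 (g x))) :
    Tendsto (fun n => ∫ x, F n x ∂μ) atTop (𝓝 (∫ x, g x ∂μ)) :=
  tendsto_integral_of_dominated_convergence (fun _ => R) hF (integrable_const R) hR hl


/-- the `L¹` and a.e. limit `u` of quasilinear viscous approximations with
mollified `BV ∩ L^∞` compactly supported initial data attains the initial data in the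
`L¹` sense: `ess lim_{t→0⁺} ∫_Ω |u(x,t) - u₀(x)| dx = 0`. -/
theorem stmt14 (d : ℕ) (Ω : Set (Fin d → ℝ)) (hΩo : IsOpen Ω)
    (hΩb : Bornology.IsBounded Ω) (T : ℝ) (hT : 0 < T)
    (f : Fin d → ℝ → ℝ) (hf : FluxOK d f)
    (B : ℝ → ℝ) (r : ℝ) (hB : DiffusionOK B r)
    (ρ : (Fin d → ℝ) → ℝ) (hρ : IsMollifier d ρ)
    (u0 : (Fin d → ℝ) → ℝ) (hBV : MemBV d Ω u0) (hu0 : LinfCompactData d Ω u0)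
    (εs : ℕ → ℝ) (hεs : ∀ k, 0 < εs k) (hεlim : Tendsto εs atTop (nhds 0))
    (v : ℕ → (Fin d → ℝ) × ℝ → ℝ)
    (hv : ∀ k, IsSolution d Ω T f B (εs k) (mollify d ρ (εs k) u0) (v k))
    (u : (Fin d → ℝ) × ℝ → ℝ) (huL1 : IntegrableOn u (Ω ×ˢ Ioo (0:ℝ) T))
    (hL1conv : Tendsto (fun k => ∫ p in Ω ×ˢ Ioo (0:ℝ) T, |v k p - u p|)
      atTop (nhds 0))
    (haeconv : ∀ᵐ p ∂(volume.restrict (Ω ×ˢ Ioo (0:ℝ) T)),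
      Tendsto (fun k => v k p) atTop (nhds (u p))) :
    ∀ δ > (0:ℝ), ∃ τ > (0:ℝ),
      ∀ᵐ t ∂(volume.restrict (Ioo (0:ℝ) τ)),
        ∫ x in Ω, |u (x, t) - u0 x| < δ := by
  intro δ hδ
  have hfin := aux_fin hΩb
  obtain ⟨⟨M0, hM0⟩, hz, K, hK, hKΩ, hKz⟩ := hu0
  obtain ⟨M, hMpos, hM⟩ : ∃ M : ℝ, 0 < M ∧ ∀ᵐ x, |u0 x| ≤ M :=
    ⟨max M0 1, by positivity, hM0.mono fun x hx => le_max_of_le_left hx⟩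
  have hu0i : Integrable u0 := by
    refine (integrableOn_iff_integrable_of_support_subset ?_).1 hBV.1
    intro x hx
    by_contra h
    exact hx (hz x h)
  have hf1 := hf.1
  have hB1 : ContDiff ℝ 1 B := hB.1.of_le (by norm_num)
  have hB0 : ∀ s, 0 ≤ B s := fun s => hB.2.2.1.le.trans (hB.2.2.2 s)
  -- mollified data
  have hms : ∀ k, ContDiff ℝ 2 (mollify d ρ (εs k) u0) := fun k => aux_moll_smooth hρ (hεs k) hu0i
  have hmM : ∀ k x, |mollify d ρ (εs k) u0 x| ≤ M := fun k x => aux_moll_bdd hρ (hεs k) hM x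
  have hmae : ∀ᵐ x ∂(volume.restrict Ω),
      Tendsto (fun k => mollify d ρ (εs k) u0 x) atTop (𝓝 (u0 x)) :=
    ae_restrict_of_ae (aux_moll_ae hρ hεs hεlim hu0i)
  have hMΩ : ∀ᵐ x ∂(volume.restrict Ω), |u0 x| ≤ M := ae_restrict_of_ae hM
  have hu0m : AEStronglyMeasurable u0 (volume.restrict Ω) := hBV.1.aestronglyMeasurable
  have hmm : ∀ k, AEStronglyMeasurable (mollify d ρ (εs k) u0) (volume.restrict Ω) :=
    fun k => (hms k).continuous.aestronglyMeasurable
  -- bounds for the solutions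
  have hvM : ∀ k, ∀ x ∈ Ω, ∀ t ∈ Ioo 0 T, |v k (x, t)| ≤ M := fun k x hx t ht =>
    aux_linf hΩo hΩb hT (hv k) hf1 hB1 hB0 (hεs k).le hMpos (hmM k) hx ht
  have hv6 : ∀ k, ∀ t ∈ Ioo 0 T, ∫ x in Ω, v k (x, t) ^ 6 ≤ ∫ x in Ω, mollify d ρ (εs k) u0 x ^ 6 :=
    fun k t ht => aux_six hΩo hΩb hT (hv k) hf1 hB1 hB0 (hεs k).le hMpos (hms k).continuous
      (hmM k) ht
  have hm6 : Tendsto (fun k => ∫ x in Ω, mollify d ρ (εs k) u0 x ^ 6) atTop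
      (𝓝 (∫ x in Ω, u0 x ^ 6)) := by
    refine aux_dct_s14 (R := M ^ 6) (fun k => (hmm k).pow 6) (fun k => Eventually.of_forall fun x => ?_) ?_
    · have := hmM k x
      rw [abs_pow]
      gcongr
    · filter_upwards [hmae] with x hx
      exact hx.pow 6
  -- the test function
  set vol : ℝ := (volume.restrict Ω).real univ with hvol
  have hvol0 : 0 ≤ vol := measureReal_nonneg
  obtain ⟨η, hη, hηvol⟩ : ∃ η : ℝ, 0 < η ∧ η * vol ≤ δ / 4 := by
    refine ⟨δ / (4 * (vol + 1)), by positivity, ?_⟩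
    rw [div_mul_eq_mul_div, div_le_div_iff₀ (by positivity) (by norm_num)]
    nlinarith
  have hφlim : Tendsto (fun k => ∫ x in Ω, |u0 x ^ 5 - mollify d ρ (εs k) u0 x ^ 5|) atTop
      (𝓝 0) := by
    have : Tendsto (fun k => ∫ x in Ω, |u0 x ^ 5 - mollify d ρ (εs k) u0 x ^ 5|) atTop
        (𝓝 (∫ x in Ω, |u0 x ^ 5 - u0 x ^ 5|)) := by
      refine aux_dct_s14 (R := M ^ 5 + M ^ 5)
        (fun k => continuous_abs.comp_aestronglyMeasurable ((hu0m.pow 5).sub ((hmm k).pow 5)))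
        (fun k => ?_) ?_
      · filter_upwards [hMΩ] with x hx
        have h1 := hmM k x
        rw [abs_abs]
        refine (abs_sub _ _).trans ?_
        rw [abs_pow, abs_pow]
        gcongr
      · filter_upwards [hmae] with x hx
        exact ((hx.pow 5).const_sub _).abs
    simpa using this
  obtain ⟨θ, hθ, hθΩ⟩ := hK.exists_cthickening_subset_open hΩo hKΩ
  have hc1 : Tendsto (fun k => (η ^ 5)⁻¹ * (96 * (2 * M *
      ∫ x in Ω, |u0 x ^ 5 - mollify d ρ (εs k) u0 x ^ 5|))) atTop (𝓝 0) := by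
    simpa using ((hφlim.const_mul (2 * M)).const_mul 96).const_mul (η ^ 5)⁻¹
  obtain ⟨n, hn1, hn2⟩ := ((hc1.eventually (gt_mem_nhds (show 0 < δ / 4 by positivity))).and
    (hεlim.eventually (gt_mem_nhds hθ))).exists
  set φ : (Fin d → ℝ) → ℝ := fun x => mollify d ρ (εs n) u0 x ^ 5 with hφdef
  have hφ : ContDiff ℝ 2 φ := (hms n).pow 5
  have hφ0 : ∀ x ∉ Metric.cthickening (εs n) K, φ x = 0 := fun x hx => by
    simp [hφdef, aux_moll_supp hρ (hεs n) hKz hx]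
  have hφc : HasCompactSupport φ := HasCompactSupport.intro hK.cthickening hφ0
  have hφΩ : tsupport φ ⊆ Ω := by
    refine (closure_minimal ?_ Metric.isClosed_cthickening).trans
      ((Metric.cthickening_mono hn2.le K).trans hθΩ)
    intro x hx
    by_contra h
    exact hx (hφ0 x h)
  have hφR : ∀ x, |φ x| ≤ M ^ 5 := fun x => by
    have := hmM n x
    simp only [hφdef, abs_pow]
    gcongr
  have hφm : AEStronglyMeasurable φ (volume.restrict Ω) := hφ.continuous.aestronglyMeasurable
  obtain ⟨E, hE⟩ := hεlim.bddAbove_range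
  obtain ⟨P, -, hPd, hP⟩ := aux_prim B hB1.continuous
  obtain ⟨D, hD0, hD⟩ := aux_D hΩb hf1 hP.continuous hφ E M
  have hweak : ∀ k, ∀ t ∈ Ioo 0 T, |(∫ x in Ω, φ x * v k (x, t))
      - ∫ x in Ω, φ x * mollify d ρ (εs k) u0 x| ≤ D * volume.real Ω * t := fun k t ht =>
    aux_weak hΩo hΩb hT (hv k) hf1 hB1 hP hPd hφ hφc hφΩ
      (fun x hx s hs => hD (εs k) ⟨(hεs k).le, hE ⟨k, rfl⟩⟩ _ (hvM k x hx s hs) x hx) ht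
  have hφm0 : Tendsto (fun k => ∫ x in Ω, φ x * mollify d ρ (εs k) u0 x) atTop
      (𝓝 (∫ x in Ω, φ x * u0 x)) := by
    refine aux_dct_s14 (R := M ^ 5 * M) (fun k => hφm.mul (hmm k))
      (fun k => Eventually.of_forall fun x => ?_) ?_
    · have h1 := hmM k x
      have h2 := hφR x
      rw [abs_mul]
      gcongr
    · filter_upwards [hmae] with x hx
      exact hx.const_mul _
  -- choice of the time
  set C : ℝ := (η ^ 5)⁻¹ * (96 * (D * volume.real Ω)) with hC
  have hC0 : 0 ≤ C := by positivity
  refine ⟨min T (δ / (4 * (C + 1))), by positivity, ?_⟩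
  have hsl : ∀ᵐ t ∂(volume.restrict (Ioo (0:ℝ) (min T (δ / (4 * (C + 1)))))),
      ∀ᵐ x ∂(volume.restrict Ω), Tendsto (fun k => v k (x, t)) atTop (𝓝 (u (x, t))) :=
    ae_restrict_of_ae_restrict_of_subset (Ioo_subset_Ioo_right (min_le_left _ _))
      (aux_slices haeconv)
  filter_upwards [hsl, ae_restrict_mem measurableSet_Ioo] with t hconv ht'
  have ht : t ∈ Ioo 0 T := ⟨ht'.1, ht'.2.trans_le (min_le_left _ _)⟩
  have htC : C * t ≤ δ / 4 := by
    have h1 : t ≤ δ / (4 * (C + 1)) := ht'.2.le.trans (min_le_right _ _)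
    rw [le_div_iff₀ (by positivity)] at h1
    nlinarith [ht'.1]
  have hvm : ∀ k, AEStronglyMeasurable (fun x => v k (x, t)) (volume.restrict Ω) := fun k =>
    ContinuousOn.aestronglyMeasurable ((aux_slice_cont (aux_sol_cont hT (hv k))
      (Ioo_subset_Icc_self ht)).mono subset_closure) hΩo.measurableSet
  have hum : AEStronglyMeasurable (fun x => u (x, t)) (volume.restrict Ω) :=
    aestronglyMeasurable_of_tendsto_ae atTop hvm hconv
  have hvb : ∀ k, ∀ᵐ x ∂(volume.restrict Ω), |v k (x, t)| ≤ M := fun k => by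
    filter_upwards [ae_restrict_mem hΩo.measurableSet] with x hx
    exact hvM k x hx t ht
  have huM : ∀ᵐ x ∂(volume.restrict Ω), |u (x, t)| ≤ M := by
    filter_upwards [hconv, ae_restrict_mem hΩo.measurableSet] with x hx hxΩ
    exact le_of_tendsto hx.abs (Eventually.of_forall fun k => hvM k x hxΩ t ht)
  have h6 : ∫ x in Ω, u (x, t) ^ 6 ≤ ∫ x in Ω, u0 x ^ 6 := by
    refine le_of_tendsto_of_tendsto' ?_ hm6 (fun k => hv6 k t ht)
    refine aux_dct_s14 (R := M ^ 6) (fun k => (hvm k).pow 6) (fun k => ?_) ?_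
    · filter_upwards [hvb k] with x hx
      rw [abs_pow]
      gcongr
    · filter_upwards [hconv] with x hx
      exact hx.pow 6
  have hA : |(∫ x in Ω, φ x * u (x, t)) - ∫ x in Ω, φ x * u0 x| ≤ D * volume.real Ω * t := by
    have h1 : Tendsto (fun k => ∫ x in Ω, φ x * v k (x, t)) atTop
        (𝓝 (∫ x in Ω, φ x * u (x, t))) := by
      refine aux_dct_s14 (R := M ^ 5 * M) (fun k => hφm.mul (hvm k)) (fun k => ?_) ?_
      · filter_upwards [hvb k] with x hx
        have h2 := hφR x
        rw [abs_mul]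
        gcongr
      · filter_upwards [hconv] with x hx
        exact hx.const_mul _
    exact le_of_tendsto (h1.sub hφm0).abs (Eventually.of_forall fun k => hweak k t ht)
  have hfinal := aux_final hum hu0m hφm hMpos.le huM hMΩ (Eventually.of_forall hφR) h6 hA hη
  have hsplit : (η ^ 5)⁻¹ * (96 * (2 * M * (∫ x in Ω, |u0 x ^ 5 - φ x|) + D * volume.real Ω * t))
      = (η ^ 5)⁻¹ * (96 * (2 * M * ∫ x in Ω, |u0 x ^ 5 - φ x|)) + C * t := by
    rw [hC]
    ring
  rw [hsplit] at hfinal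
  linarith

end
end
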